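/- arXiv:1007.1734 — 4 statements merged into one kernel-verified Lean document; each statement's English description precedes it below -/
import Mathlib

section
/- Every vertex s ∈ S is the first vertex of exactly d^t escaping paths. -/
open SimpleGraph

variable {V : Type*}

/-- The set `U` of all vertices lying on some path of length `t` from `r` to a vertex of `S`. -/
def pathUnion (G : SimpleGraph V) (t : ℕ) (r : V) (S : Set V) : Set V :=
  {v | ∃ s ∈ S, ∃ w : G.Walk r s, w.IsPath ∧ w.length = t ∧ v ∈ w.support}

/-- An *escaping path* (encoded by its two endpoints together with the walk joining them)
is a path of length `t` whose first vertex lies in `S` and whose second vertex lies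
outside `U`. -/
def IsEscapingPath (G : SimpleGraph V) (t : ℕ) (S U : Set V)
    (p : Σ u : V, Σ v : V, G.Walk u v) : Prop :=
  p.2.2.IsPath ∧ p.2.2.length = t ∧ p.1 ∈ S ∧ p.2.2.getVert 1 ∉ U

namespace SimpleGraph

/-- Two paths with the same endpoints and total length less than the girth coincide. -/
theorem Walk.IsPath.eq_of_length_add_lt_girth {G : SimpleGraph V} {u v : V} {p q : G.Walk u v}
    (hp : p.IsPath) (hq : q.IsPath) (h : p.length + q.length < G.girth) : p = q := by
  by_contra hne
  obtain ⟨_, _, _, c, hc, hle⟩ := hp.exists_isCycle_length_le_add_of_ne hq hne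
  have := girth_le_length hc
  lia

/-- A short path from `b` meets a neighbour `a` of `b` only if `a` is its second vertex. -/
theorem Walk.IsPath.mem_support_iff_of_adj {G : SimpleGraph V} {a b v : V} {p : G.Walk b v}
    (hp : p.IsPath) (hadj : G.Adj b a) (h : p.length + 1 < G.girth) :
    a ∈ p.support ↔ p.getVert 1 = a := by
  classical
  refine ⟨fun ha ↦ ?_, fun ha ↦ ha ▸ p.getVert_mem_support 1⟩
  have hle := p.length_takeUntil_le_length ha
  have heq : p.takeUntil a ha = hadj.toWalk :=
    (hp.takeUntil ha).eq_of_length_add_lt_girth (.of_adj hadj) (by simp; lia)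
  rw [← p.getVert_takeUntil ha (by simp [heq]), heq]
  simp

/-- In a `(d + 1)`-regular graph, a vertex `b` is the first vertex of `d ^ n` paths of length `n`
not passing through a given neighbour of `b` in their first step, as long as `n` is less than
the girth. -/
theorem IsRegularOfDegree.card_isPath_getVert_one_ne [Fintype V] {G : SimpleGraph V}
    [DecidableRel G.Adj] {d : ℕ} (hd : 0 < d) (hreg : G.IsRegularOfDegree (d + 1)) (n : ℕ)
    (hn : n < G.girth) {a b : V} (hadj : G.Adj b a) :
    Nat.card {p : Σ v : V, G.Walk b v // p.2.IsPath ∧ p.2.length = n ∧ p.2.getVert 1 ≠ a} =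
      d ^ n := by
  classical
  induction n generalizing a b with
  | zero =>
    rw [pow_zero, Nat.card_eq_one_iff_unique]
    refine ⟨⟨?_⟩, ⟨⟨⟨b, .nil⟩, by simp [hadj.ne]⟩⟩⟩
    rintro ⟨⟨v, p⟩, -, hp, -⟩ ⟨⟨w, q⟩, -, hq, -⟩
    obtain rfl := Walk.eq_of_length_eq_zero hp
    obtain rfl := Walk.eq_of_length_eq_zero hq
    obtain rfl := (Walk.length_eq_zero_iff.mp hp).eq_nil
    obtain rfl := (Walk.length_eq_zero_iff.mp hq).eq_nil
    rfl
  | succ n ih =>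
    let β (c : {c // G.Adj b c ∧ c ≠ a}) : Type _ :=
      {p : Σ v : V, G.Walk c.1 v // p.2.IsPath ∧ p.2.length = n ∧ p.2.getVert 1 ≠ b}
    have hβ (c) : Nat.card (β c) = d ^ n := ih (by lia) c.2.1.symm
    have hfin (c) : Finite (β c) := Nat.finite_of_card_ne_zero (by rw [hβ]; positivity)
    have hdeg : Fintype.card {c // G.Adj b c ∧ c ≠ a} = d := by
      rw [Fintype.card_subtype]
      have : ({c | G.Adj b c ∧ c ≠ a} : Finset V) = (G.neighborFinset b).erase a := by
        ext; simp [and_comm]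
      rw [this, Finset.card_erase_of_mem (by simpa), card_neighborFinset_eq_degree, hreg b]
      rfl
    let f : (Σ c, β c) → {p : Σ v : V, G.Walk b v //
        p.2.IsPath ∧ p.2.length = n + 1 ∧ p.2.getVert 1 ≠ a} := fun x ↦
      ⟨⟨x.2.1.1, .cons x.1.2.1 x.2.1.2⟩, by
        obtain ⟨⟨c, hbc, hca⟩, ⟨v, p⟩, hp, hl, hb⟩ := x
        dsimp only at *
        refine ⟨hp.cons ?_, by simp [hl], by simpa using hca⟩
        rwa [hp.mem_support_iff_of_adj hbc.symm (by lia)]⟩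
    have hf : f.Bijective := by
      constructor
      · rintro ⟨⟨c, _⟩, ⟨v, p⟩, _⟩ ⟨⟨c', _⟩, ⟨v', p'⟩, _⟩ h
        simp only [f, Subtype.mk.injEq, Sigma.mk.injEq] at h
        obtain ⟨rfl, h⟩ := h
        simp only [heq_eq_eq, Walk.cons.injEq] at h
        obtain ⟨rfl, h⟩ := h
        obtain rfl := eq_of_heq h
        rfl
      · rintro ⟨⟨v, p⟩, hp, hl, ha⟩
        cases p with
        | nil => simp at hl
        | @cons _ c _ hbc p =>
          dsimp only at hp hl ha
          rw [Walk.cons_isPath_iff] at hp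
          have hl' : p.length = n := by simpa using hl
          refine ⟨⟨⟨c, hbc, by simpa using ha⟩, ⟨v, p⟩, hp.1, hl', ?_⟩, rfl⟩
          exact fun h ↦ hp.2 (h ▸ p.getVert_mem_support 1)
    rw [← Nat.card_congr (Equiv.ofBijective f hf), Nat.card_sigma]
    simp [hβ, hdeg, pow_succ']

end SimpleGraph

/-- When the girth exceeds `2 * t + 2`, the only neighbour in `pathUnion G t r S` of a vertex
`s ∈ S` at distance `t` from `r` is the one preceding `s` on a path of length `t` from `r`. -/
theorem mem_pathUnion_iff_eq_penultimate {G : SimpleGraph V} {t : ℕ}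
    (hgirth : 2 * t + 2 < G.girth) {r s : V} {S : Set V} (hs : s ∈ S) (hdist : G.dist r s = t)
    {w : G.Walk r s} (hw : w.IsPath) (hlen : w.length = t) {v : V} (hadj : G.Adj s v) :
    v ∈ pathUnion G t r S ↔ v = w.penultimate := by
  classical
  constructor
  · rintro ⟨s', -, w', hw', hlen', hv⟩
    have hq := hw'.takeUntil hv
    have hle := w'.length_takeUntil_le_length hv
    have hsq : s ∉ (w'.takeUntil v hv).support := fun hmem ↦ by
      have := Walk.length_takeUntil_lt_length hmem hadj.ne
      have := dist_le ((w'.takeUntil v hv).takeUntil s hmem)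
      lia
    have heq := (hq.concat hsq hadj.symm).eq_of_length_add_lt_girth hw
      (by rw [Walk.length_concat]; lia)
    rw [← heq, Walk.penultimate_concat]
  · rintro rfl
    exact ⟨s, hs, w, hw, hlen, w.getVert_mem_support _⟩

/-- Every `s ∈ S` is the first vertex of exactly `d^t` escaping paths. -/
theorem stmt6 {V : Type*} [Fintype V] (t d : ℕ) (ht : 0 < t) (hd : 0 < d)
    (G : SimpleGraph V) [DecidableRel G.Adj]
    (hreg : G.IsRegularOfDegree (d + 1)) (hgirth : (2 * t + 2 : ℕ∞) < G.girth)
    (r : V) (S : Set V) (hS : ∀ s ∈ S, G.dist r s = t)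
    (U : Set V) (hU : U = pathUnion G t r S) (s : V) (hs : s ∈ S) :
    {p : Σ u : V, Σ x : V, G.Walk u x |
        IsEscapingPath G t S U p ∧ p.1 = s}.ncard = d ^ t := by
  have hgirth' : 2 * t + 2 < G.girth := by exact_mod_cast hgirth
  obtain ⟨w, hw, hlen⟩ := (Reachable.of_dist_ne_zero
    (by rw [hS s hs]; exact ht.ne')).exists_path_of_dist
  rw [hS s hs] at hlen
  have hnil : ¬ w.Nil := by
    rw [← Walk.length_eq_zero_iff]
    lia
  have hset : {p : Σ u : V, Σ x : V, G.Walk u x | IsEscapingPath G t S U p ∧ p.1 = s} =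
      Sigma.mk s '' {p : Σ v : V, G.Walk s v |
        p.2.IsPath ∧ p.2.length = t ∧ p.2.getVert 1 ≠ w.penultimate} := by
    have hiff {v : V} {q : G.Walk s v} (hq : q.length = t) :
        q.getVert 1 ∉ U ↔ q.getVert 1 ≠ w.penultimate := by
      have hadj : G.Adj s (q.getVert 1) := by
        simpa using q.adj_getVert_succ (i := 0) (by lia)
      rw [hU, mem_pathUnion_iff_eq_penultimate hgirth' hs (hS s hs) hw hlen hadj]
    ext ⟨u, v, q⟩
    constructor
    · rintro ⟨⟨hp, hl, -, hq⟩, rfl⟩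
      exact ⟨⟨v, q⟩, ⟨hp, hl, (hiff hl).mp hq⟩, rfl⟩
    · rintro ⟨⟨v, q⟩, ⟨hp, hl, hq⟩, h⟩
      cases h
      exact ⟨⟨hp, hl, hs, (hiff hl).mpr hq⟩, rfl⟩
  rw [hset, Set.ncard_image_of_injective _ sigma_mk_injective, ← Nat.card_coe_set_eq]
  exact hreg.card_isPath_getVert_one_ne hd t (by lia) (w.adj_penultimate hnil).symm
end

section
/- Let t be a positive integer, d ≥ 2 an integer, and G a finite d-regular simple graph with girth at least 2t+3. Then the number of vertices of G is at least 1 + d·∑_{i=0}^{t} (d−1)^i. -/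
open SimpleGraph

namespace SimpleGraph

variable {V : Type*} {G : SimpleGraph V}

/-- Two distinct paths with the same endpoints enclose a cycle which is no longer than the two
paths together. -/
lemma Walk.IsPath.girth_le_length_add_length {u v : V} {p q : G.Walk u v} (hp : p.IsPath)
    (hq : q.IsPath) (hpq : p ≠ q) : G.girth ≤ p.length + q.length := by
  classical
  let H : SimpleGraph V := fromEdgeSet {e | e ∈ p.edges ++ q.edges}
  have hHG : H ≤ G := by
    intro a b hab
    simp only [H, fromEdgeSet_adj, Set.mem_ofPred_eq, List.mem_append] at hab
    exact hab.1.elim p.adj_of_mem_edges q.adj_of_mem_edges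
  have hmem (e : Sym2 V) (he : e ∈ p.edges ++ q.edges) : e ∈ H.edgeSet := by
    simp only [H, edgeSet_fromEdgeSet, Set.mem_sdiff, Set.mem_ofPred_eq]
    refine ⟨he, G.not_isDiag_of_mem_edgeSet ?_⟩
    exact (List.mem_append.1 he).elim (p.edges_subset_edgeSet ·) (q.edges_subset_edgeSet ·)
  have hpH (e) (he : e ∈ p.edges) : e ∈ H.edgeSet := hmem e (List.mem_append_left _ he)
  have hqH (e) (he : e ∈ q.edges) : e ∈ H.edgeSet := hmem e (List.mem_append_right _ he)
  have hH : ¬ H.IsAcyclic := by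
    intro hac
    have h := congrArg Subtype.val
      ((hac.subsingleton_path u v).elim ⟨p.transfer H hpH, hp.transfer hpH⟩
        ⟨q.transfer H hqH, hq.transfer hqH⟩)
    refine hpq (Walk.ext_support ?_)
    rw [← p.support_transfer hpH, ← q.support_transfer hqH]
    exact congrArg Walk.support h
  obtain ⟨a, c, hc, -⟩ := exists_egirth_eq_length.2 hH
  calc G.girth ≤ (c.mapLe hHG).length := girth_le_length (hc.mapLe hHG)
    _ = c.edges.length := by simp
    _ ≤ (p.edges ++ q.edges).length := by
      refine (hc.edges_nodup.subperm fun e he ↦ ?_).length_le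
      have := c.edges_subset_edgeSet he
      simp only [H, edgeSet_fromEdgeSet, Set.mem_sdiff, Set.mem_ofPred_eq] at this
      exact this.1
    _ = p.length + q.length := by simp

lemma Walk.IsPath.eq_of_length_add_length_lt_girth {u v : V} {p q : G.Walk u v} (hp : p.IsPath)
    (hq : q.IsPath) (h : p.length + q.length < G.girth) : p = q :=
  by_contra fun hpq ↦ h.not_ge (hp.girth_le_length_add_length hq hpq)

/-- A neighbour of the end of a short path that lies on the path is the last vertex but one. -/
lemma Walk.IsPath.eq_penultimate_of_mem_support {u v w : V} {p : G.Walk u v} (hp : p.IsPath)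
    (hlen : p.length + 1 < G.girth) (hvw : G.Adj v w) (hw : w ∈ p.support) :
    w = p.penultimate := by
  classical
  have hlt : (p.dropUntil w hw).length + hvw.symm.toWalk.length < G.girth := by
    have := p.length_dropUntil_le_length hw
    simp
    omega
  have h := (hp.dropUntil hw).eq_of_length_add_length_lt_girth
    (by simpa using hvw.ne.symm : hvw.symm.toWalk.IsPath) hlt
  have hspec := p.take_spec hw
  rw [h] at hspec
  have : (p.takeUntil w hw).concat hvw.symm = p := hspec
  rw [← this, penultimate_concat]

/-- The vertices at the end of a path of length `k` starting at `r`. -/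
noncomputable def pathSphere [Fintype V] (G : SimpleGraph V) (r : V) (k : ℕ) : Finset V :=
  open Classical in {v | ∃ p : G.Walk r v, p.IsPath ∧ p.length = k}

section pathSphere

variable [Fintype V] {r v : V} {d k l : ℕ}

lemma mem_pathSphere : v ∈ G.pathSphere r k ↔ ∃ p : G.Walk r v, p.IsPath ∧ p.length = k := by
  simp [pathSphere]

lemma card_pathSphere_zero : (G.pathSphere r 0).card = 1 := by
  rw [Finset.card_eq_one]
  refine ⟨r, Finset.ext fun v ↦ ?_⟩
  rw [mem_pathSphere, Finset.mem_singleton]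
  constructor
  · rintro ⟨p, -, hp⟩
    exact (Walk.eq_of_length_eq_zero hp).symm
  · rintro rfl
    exact ⟨.nil, .nil, rfl⟩

lemma card_pathSphere_one [DecidableRel G.Adj] : (G.pathSphere r 1).card = G.degree r := by
  rw [← card_neighborFinset_eq_degree]
  congr 1
  ext v
  rw [mem_pathSphere, mem_neighborFinset]
  constructor
  · rintro ⟨p, -, hp⟩
    exact Walk.adj_of_length_eq_one hp
  · intro h
    exact ⟨h.toWalk, by simpa using h.ne, by simp⟩

lemma disjoint_pathSphere (hkl : k ≠ l) (h : k + l < G.girth) :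
    Disjoint (G.pathSphere r k) (G.pathSphere r l) := by
  rw [Finset.disjoint_left]
  intro v hk hl
  obtain ⟨p, hp, rfl⟩ := mem_pathSphere.1 hk
  obtain ⟨q, hq, rfl⟩ := mem_pathSphere.1 hl
  exact hkl (congrArg Walk.length (hp.eq_of_length_add_length_lt_girth hq h))

lemma card_pathSphere_mul_le [DecidableRel G.Adj] (hreg : G.IsRegularOfDegree d)
    (h : 2 * (k + 1) < G.girth) :
    (G.pathSphere r k).card * (d - 1) ≤ (G.pathSphere r (k + 1)).card := by
  classical
  rw [← mul_one (G.pathSphere r (k + 1)).card]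
  refine Finset.card_mul_le_card_mul G.Adj (fun v hv ↦ ?_) fun w hw ↦ ?_
  · obtain ⟨p, hp, rfl⟩ := mem_pathSphere.1 hv
    calc d - 1 = (G.neighborFinset v).card - 1 := by
          rw [card_neighborFinset_eq_degree, hreg.degree_eq]
      _ ≤ ((G.neighborFinset v).erase p.penultimate).card := Finset.pred_card_le_card_erase
      _ ≤ _ := Finset.card_le_card fun w hw ↦ ?_
    rw [Finset.mem_erase, mem_neighborFinset] at hw
    rw [Finset.mem_bipartiteAbove]
    refine ⟨mem_pathSphere.2 ⟨p.concat hw.2, hp.concat (fun hmem ↦ hw.1 ?_) hw.2, by simp⟩, hw.2⟩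
    exact hp.eq_penultimate_of_mem_support (by omega) hw.2 hmem
  · obtain ⟨q, hq, hqk⟩ := mem_pathSphere.1 hw
    suffices ∀ v ∈ (G.pathSphere r k).bipartiteBelow G.Adj w, v = q.penultimate from
      Finset.card_le_one.2 fun a ha b hb ↦ (this a ha).trans (this b hb).symm
    intro v hv
    obtain ⟨hv, hvw⟩ := (Finset.mem_bipartiteBelow _).1 hv
    obtain ⟨p, hp, hpk⟩ := mem_pathSphere.1 hv
    have hwp : w ∉ p.support := fun hmem ↦ by
      have hle := p.length_takeUntil_le_length hmem
      have := congrArg Walk.length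
        ((hp.takeUntil hmem).eq_of_length_add_length_lt_girth hq (by omega))
      omega
    have := (hp.concat hwp hvw).eq_of_length_add_length_lt_girth hq (by simp; omega)
    rw [← this, Walk.penultimate_concat]

lemma mul_pow_le_card_pathSphere [DecidableRel G.Adj] (hreg : G.IsRegularOfDegree d) :
    ∀ k, 2 * (k + 1) < G.girth → d * (d - 1) ^ k ≤ (G.pathSphere r (k + 1)).card
  | 0, _ => by rw [pow_zero, mul_one, card_pathSphere_one, hreg.degree_eq]
  | k + 1, h => calc
      d * (d - 1) ^ (k + 1) = d * (d - 1) ^ k * (d - 1) := by ring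
      _ ≤ (G.pathSphere r (k + 1)).card * (d - 1) :=
        Nat.mul_le_mul_right _ (mul_pow_le_card_pathSphere hreg k (by omega))
      _ ≤ _ := card_pathSphere_mul_le hreg h

end pathSphere

end SimpleGraph

/-- **Moore's bound.** A finite `d`-regular graph (`d ≥ 2`) with girth at least
`2t+3` has at least `1 + d·∑_{i=0}^{t} (d-1)^i` vertices. -/
theorem stmt10 {V : Type*} [Fintype V] (t d : ℕ) (ht : 0 < t) (hd : 2 ≤ d)
    (G : SimpleGraph V) [DecidableRel G.Adj]
    (hreg : G.IsRegularOfDegree d) (hgirth : (2 * t + 3 : ℕ∞) ≤ G.girth) :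
    1 + d * ∑ i ∈ Finset.range (t + 1), (d - 1) ^ i ≤ Fintype.card V := by
  classical
  have hg : 2 * t + 3 ≤ G.girth := by exact_mod_cast hgirth
  obtain ⟨r, -⟩ := exists_girth_eq_length.2 fun hG ↦ by
    rw [hG.girth_eq_zero] at hg
    omega
  calc 1 + d * ∑ i ∈ Finset.range (t + 1), (d - 1) ^ i
      = ∑ i ∈ Finset.range (t + 1), d * (d - 1) ^ i + 1 := by rw [Finset.mul_sum, add_comm]
    _ ≤ ∑ i ∈ Finset.range (t + 1), (G.pathSphere r (i + 1)).card + (G.pathSphere r 0).card := by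
      refine add_le_add (Finset.sum_le_sum fun i hi ↦ ?_) card_pathSphere_zero.ge
      have := Finset.mem_range.1 hi
      exact mul_pow_le_card_pathSphere hreg i (by omega)
    _ = ∑ i ∈ Finset.range (t + 2), (G.pathSphere r i).card := by
      rw [Finset.sum_range_succ' _ (t + 1)]
    _ = ((Finset.range (t + 2)).biUnion (G.pathSphere r)).card := by
      refine (Finset.card_biUnion fun i hi j hj hij ↦ disjoint_pathSphere hij ?_).symm
      have := Finset.mem_range.1 hi
      have := Finset.mem_range.1 hj
      omega
    _ ≤ Fintype.card V := Finset.card_le_univ _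
end

section
/- Let g ≥ 5 be an integer and let d ≥ 3 be an odd prime power. Then there exists a d-regular simple graph of girth g with at most 2·d^{1 + (3/4)g − a} vertices, where a = 4 if g ≡ 0 (mod 4), a = 11/4 if g ≡ 1 (mod 4), a = 7/2 if g ≡ 2 (mod 4), and a = 13/4 if g ≡ 3 (mod 4). -/
open SimpleGraph

/-- Two distinct paths with the same ends contain a cycle. -/
theorem egirth_le_length_add_length {V : Type*} {G : SimpleGraph V} {v w : V} {p q : G.Walk v w}
    (hp : p.IsPath) (hq : q.IsPath) (hne : p ≠ q) :
    G.egirth ≤ (p.length + q.length : ℕ) := by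
  classical
  set E : Finset (Sym2 V) := (p.edges ++ q.edges).toFinset with hE
  set H : SimpleGraph V := G ⊓ SimpleGraph.fromEdgeSet (E : Set (Sym2 V)) with hH
  have hmem : ∀ e ∈ G.edgeSet, e ∈ E → e ∈ H.edgeSet := by
    intro e
    induction e using Sym2.ind with
    | _ a b =>
      intro h1 h2
      have h1' : G.Adj a b := h1
      simp only [hH, SimpleGraph.mem_edgeSet, SimpleGraph.inf_adj, SimpleGraph.fromEdgeSet_adj]
      exact ⟨h1', h2, h1'.ne⟩
  have hpH : ∀ e ∈ p.edges, e ∈ H.edgeSet := fun e he =>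
    hmem e (p.edges_subset_edgeSet he) (by simp [hE, he])
  have hqH : ∀ e ∈ q.edges, e ∈ H.edgeSet := fun e he =>
    hmem e (q.edges_subset_edgeSet he) (by simp [hE, he])
  have hacyc : ¬ H.IsAcyclic := by
    intro h
    have := (h.subsingleton_path v w).elim ⟨p.transfer H hpH, hp.transfer hpH⟩
      ⟨q.transfer H hqH, hq.transfer hqH⟩
    apply hne
    have h2 : p.transfer H hpH = q.transfer H hqH := congrArg Subtype.val this
    apply SimpleGraph.Walk.ext_support
    rw [← SimpleGraph.Walk.support_transfer p hpH, h2, SimpleGraph.Walk.support_transfer]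
  obtain ⟨a, c, hc⟩ : ∃ a, ∃ c : H.Walk a a, c.IsCycle := by
    simpa [SimpleGraph.IsAcyclic] using hacyc
  calc G.egirth ≤ H.egirth := SimpleGraph.egirth_anti inf_le_left
    _ ≤ c.length := SimpleGraph.egirth_le_length hc
    _ ≤ (p.length + q.length : ℕ) := by
      rw [← SimpleGraph.Walk.length_edges, ← List.toFinset_card_of_nodup hc.edges_nodup]
      have h1 : c.edges.toFinset ⊆ E := by
        intro e he
        have := c.edges_subset_edgeSet (List.mem_toFinset.mp he)
        induction e using Sym2.ind with
        | _ a b =>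
          simp only [hH, SimpleGraph.mem_edgeSet, SimpleGraph.inf_adj,
            SimpleGraph.fromEdgeSet_adj] at this
          exact this.2.1
      have h2 : E.card ≤ p.length + q.length := by
        simpa [hE] using List.toFinset_card_le (p.edges ++ q.edges)
      exact_mod_cast (Finset.card_le_card h1).trans h2

/-- A finite set of even size carries a fixed-point-free involution. -/
theorem exists_involution_of_even_card {V : Type*} (S : Finset V) (hS : Even S.card) :
    ∃ σ : V → V, ∀ w ∈ S, σ w ∈ S ∧ σ w ≠ w ∧ σ (σ w) = w := by
  classical
  obtain ⟨k, hk⟩ := hS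
  have e : S ≃ Fin k × Bool := Fintype.equivOfCardEq (by simp [hk]; ring)
  refine ⟨fun w => if h : w ∈ S then e.symm ((e ⟨w, h⟩).1, !(e ⟨w, h⟩).2) else w, ?_⟩
  intro w hw
  refine ⟨by simp [hw], ?_, by simp [hw]⟩
  simp only [hw, dif_pos]
  intro h
  have h2 : e.symm ((e ⟨w, hw⟩).1, !(e ⟨w, hw⟩).2) = ⟨w, hw⟩ := Subtype.ext h
  rw [Equiv.symm_apply_eq] at h2
  have := congrArg Prod.snd h2
  simp at this

/-- Delete `u` and `v` and join every neighbour `a` of these vertices to `σ a`. -/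
def bridgedGraph {V : Type*} (G : SimpleGraph V) (u v : V) (σ : V → V) : SimpleGraph V :=
  SimpleGraph.fromRel fun a b => (a ≠ u ∧ a ≠ v) ∧ (b ≠ u ∧ b ≠ v) ∧
    (G.Adj a b ∨ ((G.Adj u a ∧ G.Adj u b ∨ G.Adj v a ∧ G.Adj v b) ∧ b = σ a ∧ a = σ b))

section Bridged

variable {V : Type*} {G : SimpleGraph V} {u v : V} {σ : V → V}

theorem bridgedGraph_adj {a b : V} : (bridgedGraph G u v σ).Adj a b ↔
    a ≠ b ∧ (a ≠ u ∧ a ≠ v) ∧ (b ≠ u ∧ b ≠ v) ∧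
    (G.Adj a b ∨ ((G.Adj u a ∧ G.Adj u b ∨ G.Adj v a ∧ G.Adj v b) ∧ b = σ a ∧ a = σ b)) := by
  simp only [bridgedGraph, SimpleGraph.fromRel_adj]
  have := G.adj_comm a b
  tauto

theorem bridgedGraph_support_avoids {a b : V} (p : (bridgedGraph G u v σ).Walk a b)
    (ha : a ≠ u ∧ a ≠ v) : u ∉ p.support ∧ v ∉ p.support := by
  induction p with
  | nil => simpa [eq_comm] using ha
  | cons h p ih =>
    have := ih (bridgedGraph_adj.mp h).2.2.1
    simp only [SimpleGraph.Walk.support_cons, List.mem_cons, not_or]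
    exact ⟨⟨ha.1.symm, this.1⟩, ⟨ha.2.symm, this.2⟩⟩

/-- A walk either stays in `G` or splits at its first step outside `G`. -/
theorem walk_split_first_not_adj {G H : SimpleGraph V} {x y : V} (p : H.Walk x y) :
    (∀ e ∈ p.edges, e ∈ G.edgeSet) ∨
    ∃ (a b : V) (p₁ : H.Walk x a) (h : H.Adj a b) (p₂ : H.Walk b y),
      p = p₁.append (SimpleGraph.Walk.cons h p₂) ∧ (∀ e ∈ p₁.edges, e ∈ G.edgeSet) ∧
        ¬ G.Adj a b := by
  induction p with
  | nil => simp
  | @cons x z y h p ih =>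
    by_cases hG : G.Adj x z
    · rcases ih with ih | ⟨a, b, p₁, hab, p₂, rfl, h1, h2⟩
      · left
        simpa [hG] using ih
      · right
        refine ⟨a, b, SimpleGraph.Walk.cons h p₁, hab, p₂, by simp, by simpa [hG] using h1, h2⟩
    · right
      exact ⟨x, z, SimpleGraph.Walk.nil, h, p, by simp, by simp, hG⟩

theorem egirth_le_of_bridged_walk {a b : V} (huv : G.Adj u v) (hab : a ≠ b)
    (ha : a ≠ u ∧ a ≠ v) (hb : b ≠ u ∧ b ≠ v) (p : (bridgedGraph G u v σ).Walk a b)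
    (hp : ∀ e ∈ p.edges, e ∈ G.edgeSet) :
    ((G.Adj u a ∧ G.Adj u b ∨ G.Adj v a ∧ G.Adj v b) → G.egirth ≤ (p.length + 2 : ℕ)) ∧
    ((G.Adj u a ∨ G.Adj v a) → (G.Adj u b ∨ G.Adj v b) → G.egirth ≤ (p.length + 3 : ℕ)) := by
  classical
  have hav := bridgedGraph_support_avoids p ha
  have key : ∀ q : G.Walk a b, q.IsPath → (u ∈ q.support ∨ v ∈ q.support) →
      G.egirth ≤ (p.length + q.length : ℕ) := by
    intro q hq hs
    have hsup : ∀ x ∈ ((p.transfer G hp).bypass).support, x ∈ p.support := by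
      intro x hx
      have := SimpleGraph.Walk.support_bypass_subset_support _ hx
      rwa [SimpleGraph.Walk.support_transfer] at this
    have hne : (p.transfer G hp).bypass ≠ q := by
      rintro rfl
      rcases hs with hs | hs
      · exact hav.1 (hsup _ hs)
      · exact hav.2 (hsup _ hs)
    refine (egirth_le_length_add_length (SimpleGraph.Walk.bypass_isPath _) hq hne).trans ?_
    have := SimpleGraph.Walk.length_bypass_le_length (p.transfer G hp)
    rw [SimpleGraph.Walk.length_transfer] at this
    exact_mod_cast Nat.add_le_add_right this _
  have k2 : ∀ x, (x = u ∨ x = v) → G.Adj x a → G.Adj x b → G.egirth ≤ (p.length + 2 : ℕ) := by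
    intro x hx h1 h2
    refine key (.cons h1.symm (.cons h2 .nil)) ?_ ?_
    · simp [SimpleGraph.Walk.cons_isPath_iff, hab, h1.ne', h2.ne]
    · rcases hx with rfl | rfl <;> simp
  have k3 : ∀ x y, (x = u ∨ x = v) → G.Adj x y → a ≠ y → b ≠ x → G.Adj x a → G.Adj y b →
      G.egirth ≤ (p.length + 3 : ℕ) := by
    intro x y hx hxy hay hbx h1 h2
    refine key (.cons h1.symm (.cons hxy (.cons h2 .nil))) ?_ ?_
    · simp [SimpleGraph.Walk.cons_isPath_iff, hab, h1.ne', h2.ne, hxy.ne, hay, hbx.symm]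
    · rcases hx with rfl | rfl <;> simp
  have k2' : G.egirth ≤ (p.length + 2 : ℕ) → G.egirth ≤ (p.length + 3 : ℕ) :=
    fun h => h.trans (by exact_mod_cast Nat.le_succ _)
  refine ⟨?_, ?_⟩
  · rintro (h | h)
    · exact k2 u (.inl rfl) h.1 h.2
    · exact k2 v (.inr rfl) h.1 h.2
  · rintro (h | h) (h' | h')
    · exact k2' (k2 u (.inl rfl) h h')
    · exact k3 u v (.inl rfl) huv ha.2 hb.1 h h'
    · exact k3 v u (.inr rfl) huv.symm ha.1 hb.2 h h'
    · exact k2' (k2 v (.inr rfl) h h')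

theorem le_egirth_bridgedGraph {g : ℕ} (huv : G.Adj u v) (hG : ((g + 1 : ℕ) : ℕ∞) ≤ G.egirth) :
    (g : ℕ∞) ≤ (bridgedGraph G u v σ).egirth := by
  rw [SimpleGraph.le_egirth]
  intro x c hc
  rcases walk_split_first_not_adj (G := G) c with h | ⟨a, b, p₁, hab, p₂, rfl, -, hnab⟩
  · have := hG.trans (SimpleGraph.egirth_le_length (hc.transfer h))
    rw [SimpleGraph.Walk.length_transfer] at this
    have h2 : g + 1 ≤ c.length := by exact_mod_cast this
    exact_mod_cast (Nat.le_succ g).trans h2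
  · have hnd := hc.edges_nodup
    have hab' := bridgedGraph_adj.mp hab
    have hnot : s(a, b) ∉ (p₂.append p₁).edges := by
      simp only [SimpleGraph.Walk.edges_append, SimpleGraph.Walk.edges_cons] at hnd ⊢
      rw [List.nodup_append] at hnd
      simp only [List.mem_append, not_or]
      refine ⟨(List.nodup_cons.mp hnd.2.1).1, fun h => hnd.2.2 _ h _ (by simp) rfl⟩
    have hlen : (p₁.append (SimpleGraph.Walk.cons hab p₂)).length =
        (p₂.append p₁).length + 1 := by simp; ring
    rw [hlen]
    generalize p₂.append p₁ = r at hnot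
    rcases hab'.2.2.2 with h | ⟨hN, hσ⟩
    · exact absurd h hnab
    rcases walk_split_first_not_adj (G := G) r with h | ⟨s, t, r₁, hst, r₂, rfl, hr, hnst⟩
    · have := hG.trans ((egirth_le_of_bridged_walk huv hab'.1.symm hab'.2.2.1 hab'.2.1 r h).1
        (by tauto))
      have h2 : g + 1 ≤ r.length + 2 := by exact_mod_cast this
      exact_mod_cast (by omega : g ≤ r.length + 1)
    · have hst' := bridgedGraph_adj.mp hst
      rcases hst'.2.2.2 with h | ⟨hN', hσ'⟩
      · exact absurd h hnst
      have hbs : b ≠ s := by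
        rintro rfl
        apply hnot
        have : t = a := by rw [hσ'.1, ← hσ.2]
        subst this
        simp [Sym2.eq_swap]
      have := hG.trans ((egirth_le_of_bridged_walk huv hbs hab'.2.2.1 hst'.2.1 r₁ hr).2
        (by tauto) (by tauto))
      have h2 : g + 1 ≤ r₁.length + 3 := by exact_mod_cast this
      have h3 : (r₁.append (SimpleGraph.Walk.cons hst r₂)).length = r₁.length + r₂.length + 1 := by
        simp; ring
      rw [h3]
      exact_mod_cast (by omega : g ≤ r₁.length + r₂.length + 1 + 1)

end Bridged

section Bridged

variable {V : Type*} {G : SimpleGraph V} {u v : V} {σ : V → V}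

theorem not_triangle_of_four_le_egirth (hG : 4 ≤ G.egirth) {a b c : V} (hab : G.Adj a b)
    (hbc : G.Adj b c) (hac : G.Adj a c) : False := by
  have := egirth_le_length_add_length (G := G) (p := .cons hab (.cons hbc .nil))
    (q := .cons hac .nil) (by simp [SimpleGraph.Walk.cons_isPath_iff, hab.ne, hbc.ne, hac.ne])
    (by simp [SimpleGraph.Walk.cons_isPath_iff, hac.ne])
    (fun h => by simpa using congrArg SimpleGraph.Walk.length h)
  have h2 := hG.trans this
  simp only [SimpleGraph.Walk.length_cons, SimpleGraph.Walk.length_nil] at h2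
  have h3 : 4 ≤ 3 := by exact_mod_cast h2
  omega

theorem ncard_neighborSet_bridgedGraph (hG : 4 ≤ G.egirth) (huv : G.Adj u v)
    (hu : ∀ w, w ≠ v → G.Adj u w → G.Adj u (σ w) ∧ σ w ≠ v ∧ σ w ≠ w ∧ σ (σ w) = w)
    (hv : ∀ w, w ≠ u → G.Adj v w → G.Adj v (σ w) ∧ σ w ≠ u ∧ σ w ≠ w ∧ σ (σ w) = w)
    {w : V} (hwu : w ≠ u) (hwv : w ≠ v) :
    ((bridgedGraph G u v σ).neighborSet w).ncard = (G.neighborSet w).ncard := by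
  classical
  have tri := @not_triangle_of_four_le_egirth V G hG
  have himage : (bridgedGraph G u v σ).neighborSet w =
      (fun x => if x = u ∨ x = v then σ w else x) '' G.neighborSet w := by
    ext y
    simp only [SimpleGraph.mem_neighborSet, Set.mem_image, bridgedGraph_adj]
    constructor
    · rintro ⟨-, -, hy, h | ⟨h | h, rfl, -⟩⟩
      · exact ⟨y, h, by simp [hy.1, hy.2]⟩
      · exact ⟨u, h.1.symm, by simp⟩
      · exact ⟨v, h.1.symm, by simp⟩
    · rintro ⟨x, hx, rfl⟩
      by_cases hxuv : x = u ∨ x = v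
      · rw [if_pos hxuv]
        rcases hxuv with rfl | rfl
        · obtain ⟨h1, h2, h3, h4⟩ := hu w hwv hx.symm
          exact ⟨h3.symm, ⟨hwu, hwv⟩, ⟨h1.ne', h2⟩, .inr ⟨.inl ⟨hx.symm, h1⟩, rfl, h4.symm⟩⟩
        · obtain ⟨h1, h2, h3, h4⟩ := hv w hwu hx.symm
          exact ⟨h3.symm, ⟨hwu, hwv⟩, ⟨h2, h1.ne'⟩, .inr ⟨.inr ⟨hx.symm, h1⟩, rfl, h4.symm⟩⟩
      · rw [if_neg hxuv]
        push Not at hxuv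
        exact ⟨hx.ne, ⟨hwu, hwv⟩, hxuv, .inl hx⟩
  have hσ : ∀ x, (x = u ∨ x = v) → G.Adj w x → ¬ G.Adj w (σ w) := by
    rintro x (rfl | rfl) hx h
    · exact tri hx (hu w hwv hx.symm).1 h
    · exact tri hx (hv w hwu hx.symm).1 h
  rw [himage, Set.InjOn.ncard_image]
  intro x hx y hy hxy
  simp only [SimpleGraph.mem_neighborSet] at hx hy
  simp only at hxy
  split_ifs at hxy with h1 h2 h2
  · by_contra hne
    rcases h1 with rfl | rfl <;> rcases h2 with rfl | rfl
    · exact hne rfl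
    · exact tri hx huv hy
    · exact tri hy huv hx
    · exact hne rfl
  · exact absurd (hxy ▸ hy) (hσ x h1 hx)
  · exact absurd (hxy ▸ hx) (hσ y h2 hy)
  · exact hxy

end Bridged

/-- From a regular graph of odd degree without cycles of length at most `g`, one obtains a smaller
regular graph of the same degree without cycles of length less than `g`. -/
theorem exists_smaller_regular {V : Type} [Finite V] [Nonempty V] {G : SimpleGraph V} {d g : ℕ}
    (hd : 3 ≤ d) (hodd : Odd d) (hg : 3 ≤ g) (hreg : ∀ w, (G.neighborSet w).ncard = d)
    (hG : ((g + 1 : ℕ) : ℕ∞) ≤ G.egirth) :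
    ∃ (W : Type) (_ : Finite W) (_ : Nonempty W) (H : SimpleGraph W),
      (∀ w, (H.neighborSet w).ncard = d) ∧ (g : ℕ∞) ≤ H.egirth ∧ Nat.card W < Nat.card V := by
  classical
  have hG4 : 4 ≤ G.egirth := le_trans (by exact_mod_cast Nat.succ_le_succ hg) hG
  obtain ⟨u⟩ := ‹Nonempty V›
  have hne : ∀ w, (G.neighborSet w).Nonempty := fun w =>
    Set.nonempty_of_ncard_ne_zero (by rw [hreg]; omega)
  obtain ⟨v, huv⟩ := hne u
  rw [SimpleGraph.mem_neighborSet] at huv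
  have hinv : ∀ x y, G.Adj x y → ∃ σ : V → V, ∀ w, w ≠ y → G.Adj x w →
      G.Adj x (σ w) ∧ σ w ≠ y ∧ σ w ≠ w ∧ σ (σ w) = w := by
    intro x y hxy
    have hfin : (G.neighborSet x \ {y}).Finite := Set.toFinite _
    obtain ⟨σ, hσ⟩ := exists_involution_of_even_card hfin.toFinset (by
      rw [← Set.ncard_eq_toFinset_card _ hfin, Set.ncard_sdiff_singleton_of_mem
        (show y ∈ G.neighborSet x from hxy), hreg]
      exact Nat.Odd.sub_odd hodd odd_one)
    refine ⟨σ, fun w h1 h2 => ?_⟩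
    have := hσ w (by simp [h1, h2])
    simpa [and_assoc] using this
  obtain ⟨σ₁, h₁⟩ := hinv u v huv
  obtain ⟨σ₂, h₂⟩ := hinv v u huv.symm
  set σ : V → V := fun w => if G.Adj u w then σ₁ w else σ₂ w with hσdef
  have hu : ∀ w, w ≠ v → G.Adj u w → G.Adj u (σ w) ∧ σ w ≠ v ∧ σ w ≠ w ∧ σ (σ w) = w := by
    intro w hw hw'
    have := h₁ w hw hw'
    simpa [hσdef, hw', this.1] using this
  have hv : ∀ w, w ≠ u → G.Adj v w → G.Adj v (σ w) ∧ σ w ≠ u ∧ σ w ≠ w ∧ σ (σ w) = w := by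
    intro w hw hw'
    have := h₂ w hw hw'
    have n1 : ¬ G.Adj u w := fun h => not_triangle_of_four_le_egirth hG4 huv hw' h
    have n2 : ¬ G.Adj u (σ₂ w) := fun h => not_triangle_of_four_le_egirth hG4 huv this.1 h
    simpa [hσdef, n1, n2] using this
  have hW : ∃ w, w ≠ u ∧ w ≠ v := by
    have : 1 < (G.neighborSet u).ncard := by rw [hreg]; omega
    obtain ⟨w, hw, hwv⟩ := Set.exists_ne_of_one_lt_ncard this v
    exact ⟨w, SimpleGraph.Adj.ne' hw, hwv⟩
  set W : Set V := {w | w ≠ u ∧ w ≠ v} with hWdef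
  refine ⟨W, inferInstance, Set.Nonempty.to_subtype hW, (bridgedGraph G u v σ).induce W, ?_, ?_, ?_⟩
  · rintro ⟨w, hw⟩
    rw [← hreg w, ← ncard_neighborSet_bridgedGraph hG4 huv hu hv hw.1 hw.2,
      ← Set.ncard_image_of_injective _ Subtype.val_injective]
    congr 1
    ext y
    simp only [Set.mem_image, SimpleGraph.mem_neighborSet, SimpleGraph.comap_adj,
      Function.Embedding.subtype_apply, Subtype.exists, exists_and_right, exists_eq_right]
    exact ⟨fun ⟨_, h⟩ => h, fun h => ⟨(bridgedGraph_adj.mp h).2.2.1, h⟩⟩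
  · exact (le_egirth_bridgedGraph huv hG).trans
      (SimpleGraph.IsContained.egirth_le ⟨(SimpleGraph.Embedding.induce W).toCopy⟩)
  · have : W.ncard < Nat.card V := Set.ncard_lt_card (fun h => by
      have : u ∈ W := h ▸ Set.mem_univ u
      exact this.1 rfl)
    simpa using this

/-- If there is a regular graph of odd degree without cycles of length less than `g`, then there
is one of girth `g` with at most as many vertices. -/
theorem exists_regular_egirth_eq {d g : ℕ} (hd : 3 ≤ d) (hodd : Odd d) (hg : 3 ≤ g) {V : Type}
    [Finite V] [Nonempty V] (G : SimpleGraph V) (hreg : ∀ w, (G.neighborSet w).ncard = d)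
    (hG : (g : ℕ∞) ≤ G.egirth) :
    ∃ (W : Type) (_ : Finite W) (H : SimpleGraph W),
      (∀ w, (H.neighborSet w).ncard = d) ∧ H.egirth = g ∧ Nat.card W ≤ Nat.card V := by
  induction hn : Nat.card V using Nat.strong_induction_on generalizing V with
  | _ n ih =>
    rcases hG.eq_or_lt with h | h
    · exact ⟨V, inferInstance, G, hreg, h.symm, hn.le⟩
    · obtain ⟨W, _, _, H, h1, h2, h3⟩ := exists_smaller_regular hd hodd hg hreg
        (by exact_mod_cast Order.add_one_le_of_lt h)
      obtain ⟨W', hW', H', h1', h2', h3'⟩ := ih (Nat.card W) (hn ▸ h3) H h1 h2 rfl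
      exact ⟨W', hW', H', h1', h2', h3'.trans (hn ▸ h3.le)⟩

section CosetGraph

variable {Γ : Type*} [Group Γ] (P : Fin 2 → Subgroup Γ)

/-- The bipartite graph on the left cosets of two subgroups, adjacency being intersection. -/
def cosetGraph : SimpleGraph (Σ b, Γ ⧸ P b) where
  Adj u v := u.1 ≠ v.1 ∧ ∃ e : Γ, u.2 = e ∧ v.2 = e
  symm := ⟨fun _ _ h => ⟨h.1.symm, h.2.imp fun _ he => he.symm⟩⟩
  loopless := ⟨fun _ h => h.1 rfl⟩

/-- `IsAltProd P n b x` says that `x` is a product of `n` nontrivial elements taken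
alternately from the two subgroups, the first one from `P b`. -/
def IsAltProd : ℕ → Fin 2 → Γ → Prop
  | 0, _, x => x = 1
  | n + 1, b, x => ∃ y ∈ P b, y ≠ 1 ∧ ∃ z, IsAltProd n (b + 1) z ∧ x = y * z

variable {P}

theorem IsAltProd.mul_mem {n : ℕ} {b : Fin 2} {x y : Γ} (hx : IsAltProd P n b x)
    (hy : y ∈ P (b + n • 1)) (hy1 : y ≠ 1) : IsAltProd P (n + 1) b (x * y) := by
  induction n generalizing b x with
  | zero =>
    simp only [IsAltProd] at hx
    subst hx
    exact ⟨y, by simpa using hy, hy1, 1, rfl, by simp⟩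
  | succ n ih =>
    obtain ⟨a, ha, ha1, z, hz, rfl⟩ := hx
    refine ⟨a, ha, ha1, z * y, ih hz ?_, mul_assoc _ _ _⟩
    rw [succ_nsmul] at hy
    rwa [add_assoc, add_comm 1]

theorem IsAltProd.split {m n : ℕ} {b : Fin 2} {x : Γ} (hx : IsAltProd P (m + n) b x) :
    ∃ y z, IsAltProd P m b y ∧ IsAltProd P n (b + m • 1) z ∧ x = y * z := by
  induction m generalizing b x with
  | zero => exact ⟨1, x, rfl, by simpa using hx, by simp⟩
  | succ m ih =>
    rw [Nat.succ_add] at hx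
    obtain ⟨a, ha, ha1, w, hw, rfl⟩ := hx
    obtain ⟨y, z, hy, hz, rfl⟩ := ih hw
    refine ⟨a * y, z, ⟨a, ha, ha1, y, hy, rfl⟩, ?_, (mul_assoc _ _ _).symm⟩
    rwa [succ_nsmul, add_comm (m • 1), ← add_assoc]

theorem IsAltProd.of_map {Δ : Type*} [Group Δ] {Q : Fin 2 → Subgroup Δ} (f : Γ →* Δ)
    (hf : Function.Injective f) (hPQ : ∀ b, ∀ y ∈ P b, f y ∈ Q b) {n : ℕ} {b : Fin 2} {x : Γ}
    (hx : IsAltProd P n b x) : IsAltProd Q n b (f x) := by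
  induction n generalizing b x with
  | zero =>
    simp only [IsAltProd] at hx ⊢
    simp [hx]
  | succ n ih =>
    obtain ⟨a, ha, ha1, w, hw, rfl⟩ := hx
    exact ⟨f a, hPQ b a ha, by simpa [map_eq_one_iff f hf] using ha1, f w, ih hw, map_mul f _ _⟩

theorem eq_add_one_of_ne_fin_two {b c : Fin 2} (h : b ≠ c) : c = b + 1 := by
  revert b c; decide

theorem fin_two_ne_add_one (b : Fin 2) : b ≠ b + 1 := by
  revert b; decide

theorem exists_edge_of_cosetGraph_adj {v w : Σ b, Γ ⧸ P b} (h : (cosetGraph P).Adj v w) :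
    ∃ e : Γ, v.2 = e ∧ w.2 = e ∧ s(v, w) = s(⟨0, (e : Γ ⧸ P 0)⟩, ⟨1, (e : Γ ⧸ P 1)⟩) := by
  obtain ⟨b, v⟩ := v
  obtain ⟨c, w⟩ := w
  obtain ⟨hbc, e, he, he'⟩ := h
  simp only at hbc he he'
  subst he he'
  refine ⟨e, rfl, rfl, ?_⟩
  fin_cases b <;> fin_cases c
  · exact absurd rfl hbc
  · rfl
  · exact Sym2.eq_swap
  · exact absurd rfl hbc

theorem isAltProd_of_isTrail {v w : Σ b, Γ ⧸ P b} (p : (cosetGraph P).Walk v w)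
    (hp : p.IsTrail) {e f : Γ} (he : v.2 = e) (hf : w.2 = f)
    (hep : s(⟨0, (e : Γ ⧸ P 0)⟩, ⟨1, (e : Γ ⧸ P 1)⟩) ∉ p.edges)
    (hfp : s(⟨0, (f : Γ ⧸ P 0)⟩, ⟨1, (f : Γ ⧸ P 1)⟩) ∉ p.edges)
    (hnil : p.length = 0 → e ≠ f) : IsAltProd P (p.length + 1) v.1 (e⁻¹ * f) := by
  induction p generalizing e with
  | nil =>
    refine ⟨e⁻¹ * f, QuotientGroup.eq.mp (he.symm.trans hf), ?_, 1, rfl, by simp⟩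
    simpa [inv_mul_eq_one] using hnil rfl
  | @cons v v' w h p ih =>
    obtain ⟨e', h1, h2, h3⟩ := exists_edge_of_cosetGraph_adj h
    rw [SimpleGraph.Walk.edges_cons, h3, List.mem_cons, not_or] at hep hfp
    rw [SimpleGraph.Walk.isTrail_cons, h3] at hp
    have hee' : e ≠ e' := by rintro rfl; exact hep.1 rfl
    have hfe' : f ≠ e' := by rintro rfl; exact hfp.1 rfl
    refine ⟨e⁻¹ * e', QuotientGroup.eq.mp (he.symm.trans h1), ?_, e'⁻¹ * f, ?_, by group⟩
    · simpa [inv_mul_eq_one] using hee'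
    · rw [← eq_add_one_of_ne_fin_two h.1]
      exact ih hp.1 h2 hf hp.2 hfp.2 fun _ => hfe'.symm

theorem even_length_of_cosetGraph_cycle {v : Σ b, Γ ⧸ P b} (c : (cosetGraph P).Walk v v) :
    Even c.length := by
  let col : (cosetGraph P).Coloring Bool :=
    SimpleGraph.Coloring.mk (fun v => decide (v.1 = 0)) (by
      intro v w h
      have := h.1
      generalize v.1 = b at *
      generalize w.1 = c at *
      revert b c
      decide)
  exact (col.even_length_iff_congr c).mpr Iff.rfl

theorem le_egirth_cosetGraph {g : ℕ} (h : ∀ s, 0 < s → 2 * s < g → ¬ IsAltProd P (2 * s) 0 1) :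
    (g : ℕ∞) ≤ (cosetGraph P).egirth := by
  rw [SimpleGraph.le_egirth]
  intro v c hc
  by_contra! hlt
  have hlt' : c.length < g := by exact_mod_cast hlt
  obtain ⟨s, hs⟩ := (even_length_of_cosetGraph_cycle c).two_dvd
  have h3 := hc.three_le_length
  have key : ∃ b, IsAltProd P (2 * s) b 1 := by
    rw [← hs]
    cases c with
    | nil => simp at h3
    | @cons _ v' _ hv p =>
      obtain ⟨e, h1, h2, he⟩ := exists_edge_of_cosetGraph_adj hv
      have htr := hc.isTrail
      rw [SimpleGraph.Walk.isTrail_cons, he] at htr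
      refine ⟨v'.1, ?_⟩
      have := isAltProd_of_isTrail p htr.1 h2 h1 htr.2 htr.2 (fun h0 => by
        simp [h0] at h3)
      simpa using this
  obtain ⟨b, hb⟩ := key
  have hs0 : 0 < s := by omega
  apply h s hs0 (by omega)
  by_cases hb0 : b = 0
  · exact hb0 ▸ hb
  · have hb1 : b = 1 := eq_add_one_of_ne_fin_two (Ne.symm hb0)
    subst hb1
    obtain ⟨k, hk⟩ : ∃ k, 2 * s = k + 1 := ⟨2 * s - 1, by omega⟩
    rw [hk] at hb ⊢
    obtain ⟨y, hy, hy1, z, hz, hyz⟩ := hb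
    have : z * y = 1 := by
      rw [eq_comm, mul_eq_one_iff_eq_inv] at hyz
      simp [hyz]
    rw [← this]
    refine IsAltProd.mul_mem hz ?_ hy1
    have hk' : (k + 1) • (1 : Fin 2) = 0 := by
      rw [← hk, mul_nsmul, show 2 • (1 : Fin 2) = 0 from rfl, nsmul_zero]
    have hk1 : k • (1 : Fin 2) = 1 := by
      rw [succ_nsmul] at hk'
      generalize k • (1 : Fin 2) = t at hk' ⊢
      revert t
      decide
    simpa [hk1] using hy

theorem ncard_neighborSet_cosetGraph (hP : P 0 ⊓ P 1 = ⊥) {q : ℕ} (hq : ∀ b, Nat.card (P b) = q)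
    (v : Σ b, Γ ⧸ P b) : ((cosetGraph P).neighborSet v).ncard = q := by
  obtain ⟨b, v⟩ := v
  induction v using QuotientGroup.induction_on with
  | H x =>
    have hset : (cosetGraph P).neighborSet ⟨b, (x : Γ ⧸ P b)⟩ =
        Set.range fun y : P b => (⟨b + 1, ((x * y : Γ) : Γ ⧸ P (b + 1))⟩ : Σ b, Γ ⧸ P b) := by
      ext ⟨c, w⟩
      simp only [SimpleGraph.mem_neighborSet, Set.mem_range]
      constructor
      · rintro ⟨h1, e, h2, h3⟩
        simp only at h1 h2 h3
        obtain rfl := eq_add_one_of_ne_fin_two h1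
        exact ⟨⟨x⁻¹ * e, QuotientGroup.eq.mp h2⟩, by simp [h3]⟩
      · rintro ⟨y, hy⟩
        rw [← hy]
        refine ⟨fin_two_ne_add_one b, x * y, ?_, rfl⟩
        exact QuotientGroup.eq.mpr (by simp)
    have hinf : ∀ y, y ∈ P b → y ∈ P (b + 1) → y = 1 := by
      intro y h1 h2
      have : y ∈ P 0 ⊓ P 1 := by
        fin_cases b
        · exact ⟨h1, h2⟩
        · exact ⟨h2, h1⟩
      simpa [hP] using this
    rw [hset, ← Set.image_univ, Set.ncard_image_of_injective, Set.ncard_univ, hq]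
    intro y z hyz
    simp only [Sigma.mk.injEq, heq_eq_eq, true_and] at hyz
    have h1 : (x * y : Γ)⁻¹ * (x * z) ∈ P (b + 1) := QuotientGroup.eq.mp hyz
    have h2 : (x * y : Γ)⁻¹ * (x * z) = (y : Γ)⁻¹ * z := by group
    rw [h2] at h1
    have := hinf _ ((P b).mul_mem ((P b).inv_mem y.2) z.2) h1
    exact Subtype.ext (inv_mul_eq_one.mp this)

theorem card_cosets_mul [Finite Γ] {q : ℕ} (hq : ∀ b, Nat.card (P b) = q) :
    Nat.card (Σ b, Γ ⧸ P b) * q = 2 * Nat.card Γ := by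
  classical
  have h : ∀ b, Nat.card (Γ ⧸ P b) * q = Nat.card Γ := fun b => by
    rw [← hq b, ← Subgroup.card_eq_card_quotient_mul_card_subgroup]
  rw [Nat.card_sigma, Fin.sum_univ_two, add_mul, h, h, two_mul]

end CosetGraph

section Unipotent

open Polynomial Matrix

/-- The total weight of `n` letters whose types alternate, starting with type `b`. -/
def altWeight (w : Fin 2 → ℕ) : ℕ → Fin 2 → ℕ
  | 0, _ => 0
  | n + 1, b => w b + altWeight w n (b + 1)

variable (N : ℕ) (w : Fin 2 → ℕ)

/-- The root subgroup of type `b`: elementary matrices over `F[X] / (X ^ N)` whose off-diagonal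
entry in row `b` is a scalar multiple of `X ^ w b`. -/
noncomputable def rootSubgroup (F : Type*) [Field F] (b : Fin 2) :
    Subgroup (SpecialLinearGroup (Fin 2) (AdjoinRoot (X ^ N : F[X]))) :=
  MonoidHom.range (G := Multiplicative F)
    { toFun := fun a => SpecialLinearGroup.transvection (fin_two_ne_add_one b)
        (AdjoinRoot.mk (X ^ N) (C a.toAdd * X ^ w b))
      map_one' := by simp
      map_mul' := fun a a' => by
        simp [add_mul, SpecialLinearGroup.transvection_add] }

variable {N w} {F : Type*} [Field F]

theorem mem_rootSubgroup {b : Fin 2} {x : SpecialLinearGroup (Fin 2) (AdjoinRoot (X ^ N : F[X]))} :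
    x ∈ rootSubgroup N w F b ↔ ∃ a : F, x = SpecialLinearGroup.transvection (fin_two_ne_add_one b)
      (AdjoinRoot.mk (X ^ N) (C a * X ^ w b)) :=
  ⟨fun ⟨a, ha⟩ => ⟨a.toAdd, ha.symm⟩, fun ⟨a, ha⟩ => ⟨Multiplicative.ofAdd a, ha.symm⟩⟩

theorem transvection_mul_apply {R : Type*} [CommRing R] (b : Fin 2) (t : R)
    (M : SpecialLinearGroup (Fin 2) R) (r c : Fin 2) :
    (↑(SpecialLinearGroup.transvection (fin_two_ne_add_one b) t * M) : Matrix (Fin 2) (Fin 2) R) r c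
      = M r c + if r = b then t * M (b + 1) c else 0 := by
  change (Matrix.transvection b (b + 1) t * M.1) r c = M.1 r c + if r = b then t * M.1 (b + 1) c else 0
  fin_cases b <;> fin_cases r <;>
    simp [Matrix.mul_apply, Fin.sum_univ_two, Matrix.transvection, Matrix.single_apply, add_comm]

theorem coeff_eq_of_mk_eq {p p' : F[X]} (h : AdjoinRoot.mk (X ^ N) p = AdjoinRoot.mk (X ^ N) p')
    {k : ℕ} (hk : k < N) : p.coeff k = p'.coeff k := by
  rw [AdjoinRoot.mk_eq_mk, X_pow_dvd_iff] at h
  simpa [sub_eq_zero] using h k hk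

/-- Lifting an alternating product to polynomial matrices, with control of the degrees. -/
theorem exists_lift_of_isAltProd (hw : 0 < w 0 + w 1) {n : ℕ} {b e : Fin 2} (he : e = b + n • 1)
    {x : SpecialLinearGroup (Fin 2) (AdjoinRoot (X ^ N : F[X]))}
    (hx : IsAltProd (rootSubgroup N w F) (n + 1) b x) :
    ∃ M : Matrix (Fin 2) (Fin 2) F[X], (∀ r c, x r c = AdjoinRoot.mk (X ^ N) (M r c)) ∧
      (M b (e + 1)).coeff (altWeight w (n + 1) b) ≠ 0 ∧
      ∀ r c d, altWeight w (n + 1) b <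
        d + (if r = b then 0 else w b) + (if c = e + 1 then 0 else w e) → (M r c).coeff d = 0 := by
  have hb1 := fin_two_ne_add_one b
  have hwb : 0 < w b + w (b + 1) := by
    fin_cases b
    · exact hw
    · rw [add_comm]; exact hw
  induction n generalizing b x with
  | zero =>
    obtain ⟨y, hy, hy1, z, hz, rfl⟩ := hx
    obtain rfl : z = 1 := hz
    obtain ⟨a, rfl⟩ := mem_rootSubgroup.mp hy
    obtain rfl : e = b := by simpa using he
    have ha : a ≠ 0 := by
      rintro rfl
      simp at hy1
    refine ⟨fun r c => (1 : Matrix (Fin 2) (Fin 2) F[X]) r c +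
      if r = e then C a * X ^ w e * (1 : Matrix (Fin 2) (Fin 2) F[X]) (e + 1) c else 0, ?_, ?_, ?_⟩
    · intro r c
      refine (transvection_mul_apply e _ 1 r c).trans ?_
      change (1 : Matrix (Fin 2) (Fin 2) _) r c +
        (if r = e then _ * (1 : Matrix (Fin 2) (Fin 2) _) (e + 1) c else 0) = _
      simp only [Matrix.one_apply]
      split_ifs <;> simp
    · simp [altWeight, hb1, ha]
    · intro r c d hd
      simp only [altWeight] at hd
      have hd1 : d = 0 → r = e → c ≠ e + 1 → False := by
        intro h1 h2 h3
        simp [h1, h2, h3] at hd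
      have hd2 : d = 0 → r = e + 1 → c = e + 1 → False := by
        intro h1 h2 h3
        simp [h1, h2, h3, hb1.symm] at hd
      have hd3 : r = e → c = e + 1 → w e < d := by
        intro h1 h2
        simpa [h1, h2] using hd
      by_cases hr : r = e
      · by_cases hc : c = e + 1
        · have := hd3 hr hc
          subst hr hc
          simp [coeff_X_pow, hb1, this.ne']
        · obtain rfl : c = e := by
            rw [eq_add_one_of_ne_fin_two (Ne.symm hc), ← eq_add_one_of_ne_fin_two hb1.symm]
          simp [hr, Matrix.one_apply, hb1.symm, coeff_one]
          tauto
      · obtain rfl : r = e + 1 := eq_add_one_of_ne_fin_two (Ne.symm hr)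
        by_cases hc : c = e + 1
        · subst hc
          simp [hr, coeff_one]
          tauto
        · simp [hr, Ne.symm hc]
  | succ n ih =>
    obtain ⟨y, hy, hy1, z, hz, rfl⟩ := hx
    obtain ⟨a, rfl⟩ := mem_rootSubgroup.mp hy
    have ha : a ≠ 0 := by
      rintro rfl
      simp at hy1
    have hbb : b + 1 + 1 = b := (eq_add_one_of_ne_fin_two hb1.symm).symm
    obtain ⟨M, hM, htop, hdeg⟩ := ih (by rw [he, succ_nsmul, add_assoc, add_comm 1]) hz
      (fin_two_ne_add_one _) (by rw [hbb, add_comm]; exact hwb)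
    have hT : altWeight w (n + 1 + 1) b = w b + altWeight w (n + 1) (b + 1) := rfl
    rw [hT]
    generalize altWeight w (n + 1) (b + 1) = T at *
    refine ⟨fun r c => M r c + if r = b then C a * X ^ w b * M (b + 1) c else 0, ?_, ?_, ?_⟩
    · intro r c
      refine (transvection_mul_apply b _ z r c).trans ?_
      rw [hM, hM]
      by_cases hr : r = b <;> simp [hr]
    · have h0 : (M b (e + 1)).coeff (T + w b) = 0 := hdeg _ _ _ (by simp [hb1]; omega)
      simp only [if_true, coeff_add, add_comm (w b) T, h0, zero_add, mul_assoc, coeff_C_mul,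
        coeff_X_pow_mul]
      exact mul_ne_zero ha htop
    · intro r c d hd
      by_cases hr : r = b
      · subst hr
        simp only [if_true, coeff_add, mul_assoc, coeff_C_mul, coeff_X_pow_mul'] at hd ⊢
        rw [hdeg r c d (by simp [hb1]; omega)]
        split_ifs with hle
        · rw [hdeg (r + 1) c (d - w r) (by simp; omega)]
          simp
        · simp
      · obtain rfl : r = b + 1 := eq_add_one_of_ne_fin_two (Ne.symm hr)
        simp only [hr, if_false] at hd ⊢
        rw [add_zero]
        exact hdeg _ _ _ (by simp; omega)

theorem altWeight_le_succ (n : ℕ) (b : Fin 2) : altWeight w n b ≤ altWeight w (n + 1) b := by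
  induction n generalizing b with
  | zero => simp [altWeight]
  | succ n ih =>
    rw [altWeight, altWeight]
    exact Nat.add_le_add_left (ih _) _

theorem not_isAltProd_one (hw : 0 < w 1) {s : ℕ} (hs : 0 < s) (hN : altWeight w s 0 < N) :
    ¬ IsAltProd (rootSubgroup N w F) (2 * s) 0 1 := by
  intro h
  rw [two_mul] at h
  obtain ⟨y, z, hy, hz, hyz⟩ := h.split
  have hyz' : y = z⁻¹ := eq_inv_of_mul_eq_one_left hyz.symm
  have h00 : y 0 0 = z 1 1 := by rw [hyz', SpecialLinearGroup.SL2_inv_expl]; rfl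
  have h01 : y 0 1 = - z 0 1 := by rw [hyz', SpecialLinearGroup.SL2_inv_expl]; rfl
  obtain ⟨n, rfl⟩ : ∃ n, s = n + 1 := ⟨s - 1, by omega⟩
  have hw' : 0 < w 0 + w 1 := by omega
  rcases Nat.even_or_odd n with hn | hn
  · have hn1 : n • (1 : Fin 2) = 0 := by
      obtain ⟨k, rfl⟩ := hn
      rw [add_nsmul, ← two_nsmul, ← mul_nsmul, mul_nsmul', show 2 • (1 : Fin 2) = 0 from rfl,
        nsmul_zero]
    rw [succ_nsmul, hn1] at hz
    simp only [zero_add] at hz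
    obtain ⟨M, hM, htop, -⟩ := exists_lift_of_isAltProd (e := 0) hw' (by simp [hn1]) hy
    obtain ⟨M', hM', -, hdeg⟩ := exists_lift_of_isAltProd (e := 1) hw' (by simp [hn1]) hz
    rw [hM, hM', ← map_neg] at h01
    apply htop
    rw [zero_add, coeff_eq_of_mk_eq h01 hN, coeff_neg, hdeg, neg_zero]
    have := altWeight_le_succ (w := w) n 0
    have h2 : altWeight w (n + 1) 1 = w 1 + altWeight w n 0 := rfl
    simp
    omega
  · have hn1 : n • (1 : Fin 2) = 1 := by
      obtain ⟨k, rfl⟩ := hn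
      rw [succ_nsmul, mul_nsmul, show 2 • (1 : Fin 2) = 0 from rfl, nsmul_zero, zero_add]
    rw [succ_nsmul, hn1] at hz
    obtain ⟨M, hM, htop, -⟩ := exists_lift_of_isAltProd (e := 1) hw' (by simp [hn1]) hy
    obtain ⟨M', hM', -, hdeg⟩ := exists_lift_of_isAltProd (e := 1) hw' (by simp [hn1]) hz
    rw [hM, hM'] at h00
    apply htop
    have h2 : (0 : Fin 2) + (1 + 1) = 0 := rfl
    rw [h2] at hdeg
    rw [show (1 : Fin 2) + 1 = 0 from rfl, coeff_eq_of_mk_eq h00 hN]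
    apply hdeg
    simp
    omega

end Unipotent

section GradedSubgroup

open Polynomial Matrix

variable (N : ℕ) (w : Fin 2 → ℕ) (F : Type*) [Field F]

/-- The class of `X ^ n` in `F[X] / (X ^ N)`. -/
noncomputable def truncPow (n : ℕ) : AdjoinRoot (X ^ N : F[X]) := AdjoinRoot.root (X ^ N) ^ n

/-- The matrices over `F[X] / (X ^ N)` that are unipotent modulo `X` on the diagonal and whose
entries only involve the degrees occurring in products of elements of the root subgroups. -/
noncomputable def gradedSubgroup : Subgroup (SpecialLinearGroup (Fin 2) (AdjoinRoot (X ^ N : F[X])))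
    where
  carrier := {x | ∃ p b c e : F[X], p.coeff 0 = 1 ∧ e.coeff 0 = 1 ∧
    x 0 0 = aeval (truncPow N F (w 0 + w 1)) p ∧
    x 0 1 = truncPow N F (w 0) * aeval (truncPow N F (w 0 + w 1)) b ∧
    x 1 0 = truncPow N F (w 1) * aeval (truncPow N F (w 0 + w 1)) c ∧
    x 1 1 = aeval (truncPow N F (w 0 + w 1)) e}
  one_mem' := ⟨1, 0, 0, 1, by simp, by simp, by simp, by simp, by simp, by simp⟩
  mul_mem' := by
    rintro x y ⟨p, b, c, e, hp, he, h00, h01, h10, h11⟩ ⟨p', b', c', e', hp', he', k00, k01, k10, k11⟩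
    have ht : truncPow N F (w 0 + w 1) = truncPow N F (w 0) * truncPow N F (w 1) := pow_add _ _ _
    have hmul : ∀ i j, (x * y) i j = x i 0 * y 0 j + x i 1 * y 1 j := fun i j => by
      change (x.1 * y.1) i j = _
      rw [Matrix.mul_apply, Fin.sum_univ_two]
    refine ⟨p * p' + X * b * c', p * b' + b * e', c * p' + e * c', X * c * b' + e * e',
      by simp [mul_coeff_zero, hp, hp'], by simp [mul_coeff_zero, he, he'], ?_, ?_, ?_, ?_⟩ <;>
    · rw [hmul]
      simp only [h00, h01, h10, h11, k00, k01, k10, k11, map_add, map_mul, aeval_X]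
      rw [ht]
      ring
  inv_mem' := by
    rintro x ⟨p, b, c, e, hp, he, h00, h01, h10, h11⟩
    refine ⟨e, -b, -c, p, he, hp, ?_, ?_, ?_, ?_⟩ <;> rw [SpecialLinearGroup.SL2_inv_expl]
    · exact h11
    · refine (congrArg Neg.neg h01).trans ?_
      simp
    · refine (congrArg Neg.neg h10).trans ?_
      simp
    · exact h00

variable {N w F}

theorem rootSubgroup_le_gradedSubgroup (b : Fin 2) :
    rootSubgroup N w F b ≤ gradedSubgroup N w F := by
  intro x hx
  obtain ⟨a, rfl⟩ := mem_rootSubgroup.mp hx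
  have hval : ∀ r c, (SpecialLinearGroup.transvection (fin_two_ne_add_one b)
      (AdjoinRoot.mk (X ^ N) (C a * X ^ w b)) : SpecialLinearGroup (Fin 2) _) r c =
      (Matrix.transvection b (b + 1) (AdjoinRoot.mk (X ^ N) (C a * X ^ w b))) r c :=
    fun _ _ => rfl
  have hmk : AdjoinRoot.mk (X ^ N) (C a * X ^ w b) = truncPow N F (w b) * algebraMap F _ a := by
    rw [map_mul, map_pow, AdjoinRoot.mk_X, AdjoinRoot.mk_C, mul_comm]
    rfl
  rw [hmk] at hval ⊢
  obtain rfl | rfl : b = 0 ∨ b = 1 := by fin_cases b <;> simp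
  · refine ⟨1, C a, 0, 1, by simp, by simp, ?_, ?_, ?_, ?_⟩ <;>
      refine (hval _ _).trans ?_ <;> simp [Matrix.transvection]
  · refine ⟨1, 0, C a, 1, by simp, by simp, ?_, ?_, ?_, ?_⟩ <;>
      refine (hval _ _).trans ?_ <;> simp [Matrix.transvection]

theorem truncPow_eq_zero {n : ℕ} (h : N ≤ n) : truncPow N F n = 0 := by
  have h0 : AdjoinRoot.root (X ^ N : F[X]) ^ N = 0 := by
    rw [← AdjoinRoot.mk_X, ← map_pow, AdjoinRoot.mk_self]
  exact pow_eq_zero_of_le h h0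

theorem truncPow_mul_aeval_eq {σ v K : ℕ} (h : N ≤ v + σ * K) {p p' : F[X]}
    (hp : ∀ k < K, p.coeff k = p'.coeff k) :
    truncPow N F v * aeval (truncPow N F σ) p = truncPow N F v * aeval (truncPow N F σ) p' := by
  rw [← sub_eq_zero, ← mul_sub, ← map_sub]
  obtain ⟨u, hu⟩ : X ^ K ∣ p - p' := X_pow_dvd_iff.mpr fun k hk => by simp [hp k hk]
  have h0 : truncPow N F v * truncPow N F σ ^ K = 0 := by
    rw [truncPow, truncPow, ← pow_mul, ← pow_add]
    exact truncPow_eq_zero h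
  rw [hu, map_mul, map_pow, aeval_X, ← mul_assoc, h0, zero_mul]

theorem isUnit_aeval_truncPow {σ : ℕ} (hσ : 0 < σ) {p : F[X]} (hp : p.coeff 0 = 1) :
    IsUnit (aeval (truncPow N F σ) p) := by
  obtain ⟨u, hu⟩ : X ∣ p - 1 := X_dvd_iff.mpr (by simp [hp])
  have hnil : IsNilpotent (truncPow N F σ * aeval (truncPow N F σ) u) := by
    refine Commute.isNilpotent_mul_right (Commute.all _ _) ⟨N, ?_⟩
    rw [truncPow, ← pow_mul]
    exact truncPow_eq_zero (Nat.le_mul_of_pos_left N hσ)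
  rw [← sub_add_cancel p 1, hu, map_add, map_mul, aeval_X, map_one, add_comm]
  exact hnil.isUnit_one_add

theorem card_gradedSubgroup_le [Finite F] (hw : 0 < w 0 + w 1) {a b c : ℕ}
    (ha : N ≤ (w 0 + w 1) * (a + 1)) (hb : N ≤ w 0 + (w 0 + w 1) * b)
    (hc : N ≤ w 1 + (w 0 + w 1) * c) :
    Finite (gradedSubgroup N w F) ∧ Nat.card (gradedSubgroup N w F) ≤ Nat.card F ^ (a + b + c) := by
  choose P B C E hP hE h00 h01 h10 h11 using fun x : gradedSubgroup N w F => x.2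
  let f : gradedSubgroup N w F → (Fin a → F) × (Fin b → F) × (Fin c → F) := fun x =>
    (fun i => (P x).coeff (i + 1), fun i => (B x).coeff i, fun i => (C x).coeff i)
  have hf : Function.Injective f := by
    intro x y hxy
    simp only [f, Prod.mk.injEq, funext_iff] at hxy
    obtain ⟨h1, h2, h3⟩ := hxy
    have e00 : x.1 0 0 = y.1 0 0 := by
      rw [h00, h00]
      have := truncPow_mul_aeval_eq (N := N) (v := 0) (p := P x) (p' := P y) (by simpa using ha) (by
        rintro (_ | k) hk
        · rw [hP, hP]
        · exact h1 ⟨k, by omega⟩)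
      simpa [truncPow] using this
    have e01 : x.1 0 1 = y.1 0 1 := by
      rw [h01, h01]
      exact truncPow_mul_aeval_eq hb fun k hk => h2 ⟨k, hk⟩
    have e10 : x.1 1 0 = y.1 1 0 := by
      rw [h10, h10]
      exact truncPow_mul_aeval_eq hc fun k hk => h3 ⟨k, hk⟩
    have hu : IsUnit (x.1 0 0) := by
      rw [h00]
      exact isUnit_aeval_truncPow hw (hP x)
    have dx := x.1.det_coe
    have dy := y.1.det_coe
    rw [Matrix.det_fin_two] at dx dy
    have e11 : x.1 1 1 = y.1 1 1 := by
      refine hu.mul_left_cancel ?_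
      rw [← e00, ← e01, ← e10] at dy
      linear_combination dx - dy
    apply Subtype.ext
    ext i j
    fin_cases i <;> fin_cases j <;> assumption
  refine ⟨Finite.of_injective f hf, (Nat.card_le_card_of_injective f hf).trans_eq ?_⟩
  simp [Nat.card_prod, Nat.card_fun, pow_add, mul_assoc]

theorem card_rootSubgroup {b : Fin 2} (hb : w b < N) :
    Nat.card (rootSubgroup N w F b) = Nat.card F := by
  have hinj : Function.Injective fun a : Multiplicative F =>
      (SpecialLinearGroup.transvection (fin_two_ne_add_one b)
        (AdjoinRoot.mk (X ^ N) (C a.toAdd * X ^ w b)) :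
          SpecialLinearGroup (Fin 2) (AdjoinRoot (X ^ N : F[X]))) := by
    intro a a' h
    have h1 : (Matrix.transvection b (b + 1) (AdjoinRoot.mk (X ^ N) (C a.toAdd * X ^ w b))) b (b + 1)
        = (Matrix.transvection b (b + 1) (AdjoinRoot.mk (X ^ N) (C a'.toAdd * X ^ w b))) b (b + 1) :=
      congrFun (congrFun (congrArg Subtype.val h) b) (b + 1)
    simp only [Matrix.transvection, Matrix.add_apply, Matrix.single_apply_same,
      add_right_inj] at h1
    simpa using coeff_eq_of_mk_eq h1 hb
  exact (Nat.card_congr (Equiv.ofInjective _ hinj)).symm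

theorem rootSubgroup_inf_eq_bot : rootSubgroup N w F 0 ⊓ rootSubgroup N w F 1 = ⊥ := by
  rw [eq_bot_iff]
  rintro x ⟨h0, h1⟩
  obtain ⟨a, rfl⟩ := mem_rootSubgroup.mp h0
  obtain ⟨a', h⟩ := mem_rootSubgroup.mp h1
  have h01 : (Matrix.transvection 0 1 (AdjoinRoot.mk (X ^ N) (C a * X ^ w 0))) (0 : Fin 2) 1
      = (Matrix.transvection 1 0 (AdjoinRoot.mk (X ^ N) (C a' * X ^ w 1))) (0 : Fin 2) (1 : Fin 2) :=
    congrFun (congrFun (congrArg Subtype.val h) 0) 1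
  have hz : AdjoinRoot.mk (X ^ N) (C a * X ^ w 0) = 0 := by
    simpa [Matrix.transvection, Matrix.single_apply] using h01
  rw [Subgroup.mem_bot, hz]
  simp

end GradedSubgroup

/-- A regular graph of large girth, whose degree is the order of a given finite field. -/
theorem exists_regular_le_egirth {F : Type} [Field F] [Finite F] {N g a b c : ℕ} {w : Fin 2 → ℕ}
    (hw0 : w 0 < N) (hw : 0 < w 1) (hw1 : w 1 < N)
    (ha : N ≤ (w 0 + w 1) * (a + 1)) (hb : N ≤ w 0 + (w 0 + w 1) * b)
    (hc : N ≤ w 1 + (w 0 + w 1) * c)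
    (hg : ∀ s, 0 < s → 2 * s < g → altWeight w s 0 < N) :
    ∃ (V : Type) (_ : Finite V) (_ : Nonempty V) (G : SimpleGraph V),
      (∀ v, (G.neighborSet v).ncard = Nat.card F) ∧ (g : ℕ∞) ≤ G.egirth ∧
        Nat.card V * Nat.card F ≤ 2 * Nat.card F ^ (a + b + c) := by
  obtain ⟨hfin, hcard⟩ := card_gradedSubgroup_le (F := F) (by omega) ha hb hc
  set Γ := gradedSubgroup N w F
  set P : Fin 2 → Subgroup Γ := fun b => (rootSubgroup N w F b).subgroupOf Γ with hP
  have hPcard : ∀ b, Nat.card (P b) = Nat.card F := fun b => by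
    rw [← card_rootSubgroup (F := F) (w := w) (b := b) (N := N) (by fin_cases b <;> assumption)]
    exact Nat.card_congr
      (Subgroup.subgroupOfEquivOfLe (rootSubgroup_le_gradedSubgroup b)).toEquiv
  have hbot : P 0 ⊓ P 1 = ⊥ := by
    rw [hP, eq_bot_iff]
    rintro x ⟨h0, h1⟩
    have hx : x.1 ∈ rootSubgroup N w F 0 ⊓ rootSubgroup N w F 1 := ⟨h0, h1⟩
    rw [rootSubgroup_inf_eq_bot] at hx
    exact Subtype.ext hx
  refine ⟨Σ b, Γ ⧸ P b, inferInstance, ⟨⟨0, (1 : Γ)⟩⟩, cosetGraph P,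
    ncard_neighborSet_cosetGraph hbot hPcard, le_egirth_cosetGraph fun s hs hsg h => ?_, ?_⟩
  · exact not_isAltProd_one hw hs (hg s hs hsg)
      (h.of_map Γ.subtype Γ.subtype_injective fun _ _ hy => hy)
  · rw [card_cosets_mul hPcard]
    exact Nat.mul_le_mul_left 2 hcard

theorem exists_regular_four_mul_le_egirth {F : Type} [Field F] [Finite F] {m : ℕ} (hm : 2 ≤ m) :
    ∃ (V : Type) (_ : Finite V) (_ : Nonempty V) (G : SimpleGraph V),
      (∀ v, (G.neighborSet v).ncard = Nat.card F) ∧ ((4 * m : ℕ) : ℕ∞) ≤ G.egirth ∧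
        Nat.card V ≤ 2 * Nat.card F ^ (3 * m - 3) := by
  have hwt : ∀ s, altWeight ![0, 1] s 0 = s / 2 ∧ altWeight ![0, 1] s 1 = (s + 1) / 2 := by
    intro s
    induction s with
    | zero => simp [altWeight]
    | succ s ih =>
      have h0 : altWeight ![0, 1] (s + 1) 0 = 0 + altWeight ![0, 1] s 1 := rfl
      have h1 : altWeight ![0, 1] (s + 1) 1 = 1 + altWeight ![0, 1] s 0 := rfl
      omega
  obtain ⟨V, hV, hV', G, hreg, hG, hcard⟩ := exists_regular_le_egirth (F := F) (N := m)
    (g := 4 * m) (a := m - 1) (b := m) (c := m - 1) (w := ![0, 1]) (by simp; omega) (by simp)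
    (by simp; omega) (by simp; omega) (by simp) (by simp; omega)
    (fun s _ hs => by rw [(hwt s).1]; omega)
  refine ⟨V, hV, hV', G, hreg, hG, Nat.le_of_mul_le_mul_right (hcard.trans_eq ?_) Nat.card_pos⟩
  rw [mul_assoc, ← pow_succ]
  congr 2
  omega

theorem exists_regular_four_mul_add_two_le_egirth {F : Type} [Field F] [Finite F] {m : ℕ}
    (hm : 1 ≤ m) :
    ∃ (V : Type) (_ : Finite V) (_ : Nonempty V) (G : SimpleGraph V),
      (∀ v, (G.neighborSet v).ncard = Nat.card F) ∧ ((4 * m + 2 : ℕ) : ℕ∞) ≤ G.egirth ∧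
        Nat.card V ≤ 2 * Nat.card F ^ (3 * m - 1) := by
  have hwt : ∀ s b, altWeight (fun _ => 1) s b = s := by
    intro s
    induction s with
    | zero => simp [altWeight]
    | succ s ih => intro b; rw [altWeight, ih, add_comm]
  obtain ⟨V, hV, hV', G, hreg, hG, hcard⟩ := exists_regular_le_egirth (F := F) (N := 2 * m + 1)
    (g := 4 * m + 2) (a := m) (b := m) (c := m) (w := fun _ => 1) (by omega) (by simp)
    (by omega) (by omega) (by omega) (by omega)
    (fun s _ hs => by rw [hwt]; omega)
  refine ⟨V, hV, hV', G, hreg, hG, Nat.le_of_mul_le_mul_right (hcard.trans_eq ?_) Nat.card_pos⟩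
  rw [mul_assoc, ← pow_succ]
  congr 2
  omega

/-- A regular graph of odd degree with girth at least `g` yields one on some `Fin n` with girth
exactly `g` and at most as many vertices. -/
theorem exists_fin_regular_girth_eq {d g : ℕ} (hd : 3 ≤ d) (hodd : Odd d) (hg : 3 ≤ g) {V : Type}
    [Finite V] [Nonempty V] (G : SimpleGraph V) (hreg : ∀ v, (G.neighborSet v).ncard = d)
    (hG : (g : ℕ∞) ≤ G.egirth) :
    ∃ (n : ℕ) (H : SimpleGraph (Fin n)) (_ : DecidableRel H.Adj),
      H.IsRegularOfDegree d ∧ H.girth = g ∧ n ≤ Nat.card V := by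
  classical
  obtain ⟨W, hW, H, hH, hHg, hcard⟩ := exists_regular_egirth_eq hd hodd hg G hreg hG
  let φ := Finite.equivFin W
  let ι : H ≃g H.map φ.toEmbedding := SimpleGraph.Iso.map φ H
  refine ⟨Nat.card W, H.map φ.toEmbedding, inferInstance, fun v => ?_, ?_, hcard⟩
  · refine (SimpleGraph.card_neighborSet_eq_degree _ v).symm.trans ?_
    refine Nat.card_eq_fintype_card.symm.trans ?_
    rw [← hH (ι.symm v)]
    exact Nat.card_congr (ι.symm.mapNeighborSet v)
  · rw [SimpleGraph.girth, ← ι.egirth_eq, hHg]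
    rfl

/-- For every `g ≥ 5` and every odd prime power `d ≥ 3` there is a
`d`-regular graph of girth `g` with at most `2·d^(1 + (3/4)g - a)` vertices, where
`a = 4, 11/4, 7/2, 13/4` according as `g ≡ 0, 1, 2, 3 (mod 4)`. -/
theorem stmt11 (g d : ℕ) (hg : 5 ≤ g) (hd : 3 ≤ d) (hpp : IsPrimePow d) (hodd : Odd d) :
    ∃ (n : ℕ) (G : SimpleGraph (Fin n)) (_ : DecidableRel G.Adj),
      G.IsRegularOfDegree d ∧ G.girth = g ∧
        (n : ℝ) ≤ 2 * (d : ℝ) ^ (1 + (3 : ℝ) / 4 * g -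
          (if g % 4 = 0 then (4 : ℝ) else if g % 4 = 1 then 11 / 4
            else if g % 4 = 2 then 7 / 2 else 13 / 4)) := by
  obtain ⟨p, k, hp, hk, rfl⟩ := (isPrimePow_nat_iff _).mp hpp
  have := Fact.mk hp
  have hF : Nat.card (GaloisField p k) = p ^ k := GaloisField.card p k hk.ne'
  suffices h : ∃ (e : ℕ), (1 + (3 : ℝ) / 4 * g -
      (if g % 4 = 0 then (4 : ℝ) else if g % 4 = 1 then 11 / 4
        else if g % 4 = 2 then 7 / 2 else 13 / 4)) = e ∧
      ∃ (V : Type) (_ : Finite V) (_ : Nonempty V) (G : SimpleGraph V),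
        (∀ v, (G.neighborSet v).ncard = p ^ k) ∧ (g : ℕ∞) ≤ G.egirth ∧
          Nat.card V ≤ 2 * (p ^ k) ^ e by
    obtain ⟨e, he, V, _, _, G, hreg, hG, hcard⟩ := h
    obtain ⟨n, H, hdec, hH, hHg, hn⟩ := exists_fin_regular_girth_eq hd hodd (by omega) G hreg hG
    refine ⟨n, H, hdec, hH, hHg, ?_⟩
    rw [he, Real.rpow_natCast]
    exact_mod_cast hn.trans hcard
  have hle : ∀ {V : Type} {G : SimpleGraph V} {g' : ℕ}, g ≤ g' → (g' : ℕ∞) ≤ G.egirth →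
      (g : ℕ∞) ≤ G.egirth := fun h h' => le_trans (by exact_mod_cast h) h'
  rw [← hF]
  obtain ⟨m, hm⟩ : ∃ m, g = 4 * m + g % 4 := ⟨g / 4, by omega⟩
  have hlt := Nat.mod_lt g (show 4 > 0 by norm_num)
  have hgm : (g : ℝ) = 4 * m + (g % 4 : ℕ) := by exact_mod_cast hm
  generalize g % 4 = i at hm hlt hgm ⊢
  interval_cases i
  · obtain ⟨V, h1, h2, G, hreg, hG, hV⟩ :=
      exists_regular_four_mul_le_egirth (F := GaloisField p k) (m := m) (by omega)
    refine ⟨3 * m - 3, ?_, V, h1, h2, G, hreg, hle (by omega) hG, hV⟩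
    rw [hgm, Nat.cast_sub (by omega)]
    push_cast
    norm_num
    ring
  · obtain ⟨V, h1, h2, G, hreg, hG, hV⟩ :=
      exists_regular_four_mul_add_two_le_egirth (F := GaloisField p k) (m := m) (by omega)
    refine ⟨3 * m - 1, ?_, V, h1, h2, G, hreg, hle (by omega) hG, hV⟩
    rw [hgm, Nat.cast_sub (by omega)]
    push_cast
    norm_num
    ring
  · obtain ⟨V, h1, h2, G, hreg, hG, hV⟩ :=
      exists_regular_four_mul_add_two_le_egirth (F := GaloisField p k) (m := m) (by omega)
    refine ⟨3 * m - 1, ?_, V, h1, h2, G, hreg, hle (by omega) hG, hV⟩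
    rw [hgm, Nat.cast_sub (by omega)]
    push_cast
    norm_num
    ring
  · obtain ⟨V, h1, h2, G, hreg, hG, hV⟩ :=
      exists_regular_four_mul_le_egirth (F := GaloisField p k) (m := m + 1) (by omega)
    refine ⟨3 * m, ?_, V, h1, h2, G, hreg, hle (by omega) hG, hV⟩
    rw [hgm]
    push_cast
    norm_num
    ring
end

section
/- Let d ≥ 3 be a prime power. Then there exists a d-regular simple graph with girth 12 and at most 2·d^5 vertices. -/
/-- If the weights `aᵢ` annihilate all cubic polynomials at five cyclically ordered nodes with
neighbouring nodes distinct, then nodes at cyclic distance two are distinct. -/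
theorem ne_of_moments_eq_zero {F : Type*} [Field F] {x₀ x₁ x₂ x₃ x₄ a₀ a₁ a₂ a₃ a₄ : F}
    (h₀ : a₀ + a₁ + a₂ + a₃ + a₄ = 0)
    (h₁ : a₀ * x₀ + a₁ * x₁ + a₂ * x₂ + a₃ * x₃ + a₄ * x₄ = 0)
    (h₂ : a₀ * x₀ ^ 2 + a₁ * x₁ ^ 2 + a₂ * x₂ ^ 2 + a₃ * x₃ ^ 2 + a₄ * x₄ ^ 2 = 0)
    (h₃ : a₀ * x₀ ^ 3 + a₁ * x₁ ^ 3 + a₂ * x₂ ^ 3 + a₃ * x₃ ^ 3 + a₄ * x₄ ^ 3 = 0)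
    (n₂₃ : x₂ ≠ x₃) (n₃₄ : x₃ ≠ x₄) (n₄₀ : x₄ ≠ x₀)
    (m₃ : a₃ ≠ 0) (m₄ : a₄ ≠ 0) : x₀ ≠ x₂ := by
  rintro rfl
  have e₄ : a₄ * ((x₄ - x₀) * ((x₄ - x₁) * (x₄ - x₃))) = 0 := by
    linear_combination h₃ - (x₀ + x₁ + x₃) * h₂ + (x₀ * x₁ + x₀ * x₃ + x₁ * x₃) * h₁
      - x₀ * x₁ * x₃ * h₀
  have e₁ : x₄ = x₁ := by
    simpa [m₄, sub_eq_zero, n₄₀, n₃₄.symm] using e₄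
  subst e₁
  have e₃ : a₃ * ((x₃ - x₀) * (x₃ - x₄)) = 0 := by
    linear_combination h₂ - (x₀ + x₄) * h₁ + x₀ * x₄ * h₀
  simp [m₃, sub_eq_zero, n₂₃.symm, n₃₄] at e₃

/-- The closing conditions for a cycle of length ten have no solution. -/
theorem no_closed_pentagon {F : Type*} [Field F] {x₀ x₁ x₂ x₃ x₄ a₀ a₁ a₂ a₃ a₄ : F}
    (h₀ : a₀ + a₁ + a₂ + a₃ + a₄ = 0)
    (h₁ : a₀ * x₀ + a₁ * x₁ + a₂ * x₂ + a₃ * x₃ + a₄ * x₄ = 0)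
    (h₂ : a₀ * x₀ ^ 2 + a₁ * x₁ ^ 2 + a₂ * x₂ ^ 2 + a₃ * x₃ ^ 2 + a₄ * x₄ ^ 2 = 0)
    (h₃ : a₀ * x₀ ^ 3 + a₁ * x₁ ^ 3 + a₂ * x₂ ^ 3 + a₃ * x₃ ^ 3 + a₄ * x₄ ^ 3 = 0)
    (hQ : a₁ * x₁ * (a₀ * (x₁ - x₀) ^ 2) + a₂ * x₂ * (a₀ * (x₂ - x₀) ^ 2 + a₁ * (x₂ - x₁) ^ 2)
      + a₃ * x₃ * (a₀ * (x₃ - x₀) ^ 2 + a₁ * (x₃ - x₁) ^ 2 + a₂ * (x₃ - x₂) ^ 2)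
      + a₄ * x₄ * (a₀ * (x₄ - x₀) ^ 2 + a₁ * (x₄ - x₁) ^ 2 + a₂ * (x₄ - x₂) ^ 2
        + a₃ * (x₄ - x₃) ^ 2) = 0)
    (n₀₁ : x₀ ≠ x₁) (n₁₂ : x₁ ≠ x₂) (n₂₃ : x₂ ≠ x₃) (n₃₄ : x₃ ≠ x₄) (n₄₀ : x₄ ≠ x₀)
    (m₀ : a₀ ≠ 0) (m₁ : a₁ ≠ 0) (m₂ : a₂ ≠ 0) (m₃ : a₃ ≠ 0) (m₄ : a₄ ≠ 0) : False := by
  have n₀₂ : x₀ ≠ x₂ := ne_of_moments_eq_zero h₀ h₁ h₂ h₃ n₂₃ n₃₄ n₄₀ m₃ m₄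
  have n₁₃ : x₁ ≠ x₃ := ne_of_moments_eq_zero (a₀ := a₁) (a₁ := a₂) (a₂ := a₃) (a₃ := a₄)
    (a₄ := a₀) (x₁ := x₂) (by linear_combination h₀) (by linear_combination h₁)
    (by linear_combination h₂) (by linear_combination h₃) n₃₄ n₄₀ n₀₁ m₄ m₀
  have n₂₄ : x₂ ≠ x₄ := ne_of_moments_eq_zero (a₀ := a₂) (a₁ := a₃) (a₂ := a₄) (a₃ := a₀)
    (a₄ := a₁) (x₁ := x₃) (by linear_combination h₀) (by linear_combination h₁)
    (by linear_combination h₂) (by linear_combination h₃) n₄₀ n₀₁ n₁₂ m₀ m₁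
  have n₃₀ : x₃ ≠ x₀ := ne_of_moments_eq_zero (a₀ := a₃) (a₁ := a₄) (a₂ := a₀) (a₃ := a₁)
    (a₄ := a₂) (x₁ := x₄) (by linear_combination h₀) (by linear_combination h₁)
    (by linear_combination h₂) (by linear_combination h₃) n₀₁ n₁₂ n₂₃ m₁ m₂
  have n₄₁ : x₄ ≠ x₁ := ne_of_moments_eq_zero (a₀ := a₄) (a₁ := a₀) (a₂ := a₁) (a₃ := a₂)
    (a₄ := a₃) (x₁ := x₀) (by linear_combination h₀) (by linear_combination h₁)
    (by linear_combination h₂) (by linear_combination h₃) n₁₂ n₂₃ n₃₄ m₂ m₃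
  rw [← sub_ne_zero] at n₀₁ n₁₂ n₂₃ n₃₄ n₄₀ n₀₂ n₁₃ n₂₄ n₃₀ n₄₁
  -- the vector `a` is proportional to the vector of Vandermonde products of the other nodes
  obtain ⟨c, hc⟩ : ∃ c, a₀ = c * ((x₁ - x₂) * (x₂ - x₃) * (x₃ - x₄) * (x₁ - x₃) * (x₂ - x₄)
      * (x₄ - x₁)) :=
    ⟨a₀ / ((x₁ - x₂) * (x₂ - x₃) * (x₃ - x₄) * (x₁ - x₃) * (x₂ - x₄) * (x₄ - x₁)), by
      field_simp⟩
  have hc₀ : c ≠ 0 := by rintro rfl; simp [m₀] at hc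
  have e₁ : a₁ = c * ((x₂ - x₃) * (x₃ - x₄) * (x₄ - x₀) * (x₂ - x₄) * (x₃ - x₀)
      * (x₀ - x₂)) := by
    have : a₁ * ((x₁ - x₂) * (x₁ - x₃) * (x₄ - x₁))
      = a₀ * ((x₀ - x₂) * (x₃ - x₀) * (x₄ - x₀)) := by
      linear_combination -h₃ + (x₂ + x₃ + x₄) * h₂ - (x₂ * x₃ + x₂ * x₄ + x₃ * x₄) * h₁
        + x₂ * x₃ * x₄ * h₀
    rw [hc] at this
    apply mul_right_cancel₀ (mul_ne_zero (mul_ne_zero n₁₂ n₁₃) n₄₁)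
    linear_combination this
  have e₂ : a₂ = c * ((x₃ - x₄) * (x₄ - x₀) * (x₀ - x₁) * (x₃ - x₀) * (x₄ - x₁)
      * (x₁ - x₃)) := by
    have : a₂ * ((x₁ - x₂) * (x₂ - x₃) * (x₂ - x₄))
      = a₀ * ((x₀ - x₁) * (x₃ - x₀) * (x₄ - x₀)) := by
      linear_combination -h₃ + (x₁ + x₃ + x₄) * h₂ - (x₁ * x₃ + x₁ * x₄ + x₃ * x₄) * h₁
        + x₁ * x₃ * x₄ * h₀
    rw [hc] at this
    apply mul_right_cancel₀ (mul_ne_zero (mul_ne_zero n₁₂ n₂₃) n₂₄)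
    linear_combination this
  have e₃ : a₃ = c * ((x₄ - x₀) * (x₀ - x₁) * (x₁ - x₂) * (x₄ - x₁) * (x₀ - x₂)
      * (x₂ - x₄)) := by
    have : a₃ * ((x₁ - x₃) * (x₂ - x₃) * (x₃ - x₄))
      = a₀ * ((x₀ - x₁) * (x₀ - x₂) * (x₄ - x₀)) := by
      linear_combination h₃ - (x₁ + x₂ + x₄) * h₂ + (x₁ * x₂ + x₁ * x₄ + x₂ * x₄) * h₁
        - x₁ * x₂ * x₄ * h₀
    rw [hc] at this
    apply mul_right_cancel₀ (mul_ne_zero (mul_ne_zero n₁₃ n₂₃) n₃₄)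
    linear_combination this
  have e₄ : a₄ = c * ((x₀ - x₁) * (x₁ - x₂) * (x₂ - x₃) * (x₀ - x₂) * (x₁ - x₃)
      * (x₃ - x₀)) := by
    linear_combination h₀ - hc - e₁ - e₂ - e₃
  subst hc e₁ e₂ e₃ e₄
  have key : c ^ 2 * ((x₀ - x₁) ^ 2 * (x₁ - x₂) ^ 2 * (x₂ - x₃) ^ 2 * (x₃ - x₄) ^ 2
      * (x₄ - x₀) ^ 2 * ((x₀ - x₂) * (x₁ - x₃) * (x₂ - x₄) * (x₃ - x₀) * (x₄ - x₁))) = 0 := by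
    clear h₀ h₁ h₂ h₃
    linear_combination -hQ
  simp [hc₀, n₀₁, n₁₂, n₂₃, n₃₄, n₄₀, n₀₂, n₁₃, n₂₄, n₃₀, n₄₁] at key

/-- The closing conditions for a cycle of length eight have no solution. -/
theorem no_closed_square {F : Type*} [Field F] {x₀ x₁ x₂ x₃ a₀ a₁ a₂ a₃ : F}
    (h₀ : a₀ + a₁ + a₂ + a₃ = 0)
    (h₁ : a₀ * x₀ + a₁ * x₁ + a₂ * x₂ + a₃ * x₃ = 0)
    (h₂ : a₀ * x₀ ^ 2 + a₁ * x₁ ^ 2 + a₂ * x₂ ^ 2 + a₃ * x₃ ^ 2 = 0)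
    (h₃ : a₀ * x₀ ^ 3 + a₁ * x₁ ^ 3 + a₂ * x₂ ^ 3 + a₃ * x₃ ^ 3 = 0)
    (hQ : a₁ * x₁ * (a₀ * (x₁ - x₀) ^ 2) + a₂ * x₂ * (a₀ * (x₂ - x₀) ^ 2 + a₁ * (x₂ - x₁) ^ 2)
      + a₃ * x₃ * (a₀ * (x₃ - x₀) ^ 2 + a₁ * (x₃ - x₁) ^ 2 + a₂ * (x₃ - x₂) ^ 2) = 0)
    (n₀₁ : x₀ ≠ x₁) (n₁₂ : x₁ ≠ x₂) (n₂₃ : x₂ ≠ x₃) (n₃₀ : x₃ ≠ x₀)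
    (m₀ : a₀ ≠ 0) (m₁ : a₁ ≠ 0) (m₂ : a₂ ≠ 0) (m₃ : a₃ ≠ 0) : False := by
  have e₁ : a₃ * ((x₃ - x₀) * ((x₃ - x₁) * (x₃ - x₂))) = 0 := by
    linear_combination h₃ - (x₀ + x₁ + x₂) * h₂ + (x₀ * x₁ + x₀ * x₂ + x₁ * x₂) * h₁
      - x₀ * x₁ * x₂ * h₀
  have e₂ : a₂ * ((x₂ - x₀) * ((x₂ - x₁) * (x₂ - x₃))) = 0 := by
    linear_combination h₃ - (x₀ + x₁ + x₃) * h₂ + (x₀ * x₁ + x₀ * x₃ + x₁ * x₃) * h₁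
      - x₀ * x₁ * x₃ * h₀
  have f₁ : x₃ = x₁ := by simpa [m₃, sub_eq_zero, n₃₀, n₂₃.symm] using e₁
  have f₂ : x₂ = x₀ := by simpa [m₂, sub_eq_zero, n₁₂.symm, n₂₃] using e₂
  subst f₁ f₂
  rw [← sub_ne_zero] at n₀₁
  have g₂ : a₂ = -a₀ := by
    apply mul_right_cancel₀ n₀₁
    linear_combination h₁ - x₃ * h₀
  have g₃ : a₃ = -a₁ := by linear_combination h₀ - g₂
  subst g₂ g₃
  have key : a₀ * a₁ * (x₂ - x₃) ^ 3 = 0 := by linear_combination -hQ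
  simp [m₀, m₁, n₀₁] at key

/-- Incidence between a point `p` and a line `l` of the affine part of the split Cayley hexagon. -/
def HexInc {F : Type*} [Field F] (p l : Fin 5 → F) : Prop :=
  p 1 + l 1 = p 0 * l 0 ∧ p 2 + l 2 = p 0 * l 1 ∧ p 3 + l 3 = p 0 * l 2 ∧
    p 4 + l 4 = p 1 * l 2 - p 2 * l 1

/-- The bipartite incidence graph of the affine part of the split Cayley hexagon; points are on the
left and lines on the right. -/
def hexGraph (F : Type*) [Field F] : SimpleGraph ((Fin 5 → F) ⊕ (Fin 5 → F)) where
  Adj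
    | .inl p, .inr l => HexInc p l
    | .inr l, .inl p => HexInc p l
    | _, _ => False
  symm := ⟨by rintro (_ | _) (_ | _) h <;> exact h⟩
  loopless := ⟨by rintro (_ | _) h <;> exact h⟩

section HexGraph

variable {F : Type*} [Field F]

@[simp] theorem hexGraph_adj_inl_inr {p l : Fin 5 → F} :
    (hexGraph F).Adj (.inl p) (.inr l) ↔ HexInc p l := Iff.rfl

@[simp] theorem hexGraph_adj_inr_inl {p l : Fin 5 → F} :
    (hexGraph F).Adj (.inr l) (.inl p) ↔ HexInc p l := Iff.rfl

@[simp] theorem not_hexGraph_adj_inl_inl {p q : Fin 5 → F} :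
    ¬ (hexGraph F).Adj (.inl p) (.inl q) := id

@[simp] theorem not_hexGraph_adj_inr_inr {l m : Fin 5 → F} :
    ¬ (hexGraph F).Adj (.inr l) (.inr m) := id

/-- The point of the line `l` with first coordinate `x`. -/
def hexPoint (l : Fin 5 → F) (x : F) : Fin 5 → F :=
  ![x, x * l 0 - l 1, x * l 1 - l 2, x * l 2 - l 3, x * (l 0 * l 2 - l 1 ^ 2) - l 4]

/-- The line through the point `p` with first coordinate `y`. -/
def hexLine (p : Fin 5 → F) (y : F) : Fin 5 → F :=
  ![y, p 0 * y - p 1, p 0 * (p 0 * y - p 1) - p 2, p 0 * (p 0 * (p 0 * y - p 1) - p 2) - p 3,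
    p 0 * y * (p 0 * p 1 - p 2) - p 0 * p 1 ^ 2 - p 4]

theorem hexInc_iff_eq_hexPoint {p l : Fin 5 → F} : HexInc p l ↔ p = hexPoint l (p 0) := by
  simp only [HexInc, hexPoint, funext_iff, Fin.forall_fin_succ]
  simp
  constructor
  · rintro ⟨h₁, h₂, h₃, h₄⟩
    refine ⟨by linear_combination h₁, by linear_combination h₂, by linear_combination h₃, ?_⟩
    linear_combination h₄ + l 2 * h₁ - l 1 * h₂
  · rintro ⟨h₁, h₂, h₃, h₄⟩
    refine ⟨by linear_combination h₁, by linear_combination h₂, by linear_combination h₃, ?_⟩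
    linear_combination h₄ - l 2 * h₁ + l 1 * h₂

theorem hexInc_iff_eq_hexLine {p l : Fin 5 → F} : HexInc p l ↔ l = hexLine p (l 0) := by
  simp only [HexInc, hexLine, funext_iff, Fin.forall_fin_succ]
  simp
  constructor
  · rintro ⟨h₁, h₂, h₃, h₄⟩
    have e₁ : l 1 = p 0 * l 0 - p 1 := by linear_combination h₁
    have e₂ : l 2 = p 0 * (p 0 * l 0 - p 1) - p 2 := by linear_combination h₂ + p 0 * e₁
    refine ⟨e₁, e₂, by linear_combination h₃ + p 0 * e₂, ?_⟩
    linear_combination h₄ + p 1 * e₂ - p 2 * e₁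
  · rintro ⟨h₁, h₂, h₃, h₄⟩
    refine ⟨by linear_combination h₁, by linear_combination h₂ - p 0 * h₁,
      by linear_combination h₃ - p 0 * h₂, ?_⟩
    linear_combination h₄ - p 1 * h₂ + p 2 * h₁

theorem hexInc_hexPoint (l : Fin 5 → F) (x : F) : HexInc (hexPoint l x) l :=
  hexInc_iff_eq_hexPoint.2 rfl

theorem hexInc_hexLine (p : Fin 5 → F) (y : F) : HexInc p (hexLine p y) :=
  hexInc_iff_eq_hexLine.2 rfl

theorem HexInc.point_zero_ne {p q l : Fin 5 → F} (hp : HexInc p l) (hq : HexInc q l)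
    (h : p ≠ q) : p 0 ≠ q 0 := by
  intro e
  rw [hexInc_iff_eq_hexPoint] at hp hq
  exact h (by rw [hp, hq, e])

theorem HexInc.line_zero_ne {p l m : Fin 5 → F} (hl : HexInc p l) (hm : HexInc p m)
    (h : l ≠ m) : m 0 - l 0 ≠ 0 := by
  intro e
  rw [hexInc_iff_eq_hexLine] at hl hm
  exact h (by rw [hl, hm, sub_eq_zero.1 e])

/-- Two lines through a common point differ by a multiple of a vector determined by the point. -/
theorem HexInc.line_sub {p l m : Fin 5 → F} (hl : HexInc p l) (hm : HexInc p m) :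
    m 1 = l 1 + (m 0 - l 0) * p 0 ∧ m 2 = l 2 + (m 0 - l 0) * p 0 ^ 2 ∧
      m 3 = l 3 + (m 0 - l 0) * p 0 ^ 3 ∧
      m 4 = l 4 + (m 0 - l 0) * p 0 * (p 0 ^ 2 * l 0 - 2 * p 0 * l 1 + l 2) := by
  obtain ⟨h₁, h₂, h₃, h₄⟩ := hl
  obtain ⟨k₁, k₂, k₃, k₄⟩ := hm
  have e₁ : m 1 = l 1 + (m 0 - l 0) * p 0 := by linear_combination k₁ - h₁
  have e₂ : m 2 = l 2 + (m 0 - l 0) * p 0 ^ 2 := by linear_combination k₂ - h₂ + p 0 * e₁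
  refine ⟨e₁, e₂, by linear_combination k₃ - h₃ + p 0 * e₂, ?_⟩
  linear_combination k₄ - h₄ + p 1 * e₂ - p 2 * e₁ + (m 0 - l 0) * p 0 ^ 2 * h₁
    - (m 0 - l 0) * p 0 * h₂

theorem hexGraph_not_pentagon {p₀ p₁ p₂ p₃ p₄ l₀ l₁ l₂ l₃ l₄ : Fin 5 → F}
    (i₀ : HexInc p₀ l₀) (j₀ : HexInc p₀ l₁) (i₁ : HexInc p₁ l₁) (j₁ : HexInc p₁ l₂)
    (i₂ : HexInc p₂ l₂) (j₂ : HexInc p₂ l₃) (i₃ : HexInc p₃ l₃) (j₃ : HexInc p₃ l₄)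
    (i₄ : HexInc p₄ l₄) (j₄ : HexInc p₄ l₀)
    (n₀ : p₀ ≠ p₁) (n₁ : p₁ ≠ p₂) (n₂ : p₂ ≠ p₃) (n₃ : p₃ ≠ p₄) (n₄ : p₄ ≠ p₀)
    (m₀ : l₀ ≠ l₁) (m₁ : l₁ ≠ l₂) (m₂ : l₂ ≠ l₃) (m₃ : l₃ ≠ l₄) (m₄ : l₄ ≠ l₀) : False := by
  obtain ⟨a₁, a₂, a₃, a₄⟩ := i₀.line_sub j₀
  obtain ⟨b₁, b₂, b₃, b₄⟩ := i₁.line_sub j₁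
  obtain ⟨c₁, c₂, c₃, c₄⟩ := i₂.line_sub j₂
  obtain ⟨d₁, d₂, d₃, d₄⟩ := i₃.line_sub j₃
  obtain ⟨e₁, e₂, e₃, e₄⟩ := i₄.line_sub j₄
  have t₁ := b₁.trans (congrArg (· + _) a₁)
  have t₂ := b₂.trans (congrArg (· + _) a₂)
  have u₁ := c₁.trans (congrArg (· + _) t₁)
  have u₂ := c₂.trans (congrArg (· + _) t₂)
  have v₁ := d₁.trans (congrArg (· + _) u₁)
  have v₂ := d₂.trans (congrArg (· + _) u₂)
  rw [a₁, a₂] at b₄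
  rw [t₁, t₂] at c₄
  rw [u₁, u₂] at d₄
  rw [v₁, v₂] at e₄
  have h₁ : (l₁ 0 - l₀ 0) * p₀ 0 + (l₂ 0 - l₁ 0) * p₁ 0 + (l₃ 0 - l₂ 0) * p₂ 0
      + (l₄ 0 - l₃ 0) * p₃ 0 + (l₀ 0 - l₄ 0) * p₄ 0 = 0 := by
    linear_combination -a₁ - b₁ - c₁ - d₁ - e₁
  have h₂ : (l₁ 0 - l₀ 0) * p₀ 0 ^ 2 + (l₂ 0 - l₁ 0) * p₁ 0 ^ 2 + (l₃ 0 - l₂ 0) * p₂ 0 ^ 2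
      + (l₄ 0 - l₃ 0) * p₃ 0 ^ 2 + (l₀ 0 - l₄ 0) * p₄ 0 ^ 2 = 0 := by
    linear_combination -a₂ - b₂ - c₂ - d₂ - e₂
  have h₃ : (l₁ 0 - l₀ 0) * p₀ 0 ^ 3 + (l₂ 0 - l₁ 0) * p₁ 0 ^ 3 + (l₃ 0 - l₂ 0) * p₂ 0 ^ 3
      + (l₄ 0 - l₃ 0) * p₃ 0 ^ 3 + (l₀ 0 - l₄ 0) * p₄ 0 ^ 3 = 0 := by
    linear_combination -a₃ - b₃ - c₃ - d₃ - e₃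
  refine no_closed_pentagon (by ring) h₁ h₂ h₃ ?_ (j₀.point_zero_ne i₁ n₀) (j₁.point_zero_ne i₂ n₁)
    (j₂.point_zero_ne i₃ n₂) (j₃.point_zero_ne i₄ n₃) (j₄.point_zero_ne i₀ n₄)
    (i₀.line_zero_ne j₀ m₀) (i₁.line_zero_ne j₁ m₁) (i₂.line_zero_ne j₂ m₂)
    (i₃.line_zero_ne j₃ m₃) (i₄.line_zero_ne j₄ m₄)
  linear_combination -a₄ - b₄ - c₄ - d₄ - e₄ - l₀ 0 * h₃ + 2 * l₀ 1 * h₂ - l₀ 2 * h₁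

theorem hexGraph_not_square {p₀ p₁ p₂ p₃ l₀ l₁ l₂ l₃ : Fin 5 → F}
    (i₀ : HexInc p₀ l₀) (j₀ : HexInc p₀ l₁) (i₁ : HexInc p₁ l₁) (j₁ : HexInc p₁ l₂)
    (i₂ : HexInc p₂ l₂) (j₂ : HexInc p₂ l₃) (i₃ : HexInc p₃ l₃) (j₃ : HexInc p₃ l₀)
    (n₀ : p₀ ≠ p₁) (n₁ : p₁ ≠ p₂) (n₂ : p₂ ≠ p₃) (n₃ : p₃ ≠ p₀)
    (m₀ : l₀ ≠ l₁) (m₁ : l₁ ≠ l₂) (m₂ : l₂ ≠ l₃) (m₃ : l₃ ≠ l₀) : False := by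
  obtain ⟨a₁, a₂, a₃, a₄⟩ := i₀.line_sub j₀
  obtain ⟨b₁, b₂, b₃, b₄⟩ := i₁.line_sub j₁
  obtain ⟨c₁, c₂, c₃, c₄⟩ := i₂.line_sub j₂
  obtain ⟨d₁, d₂, d₃, d₄⟩ := i₃.line_sub j₃
  have t₁ := b₁.trans (congrArg (· + _) a₁)
  have t₂ := b₂.trans (congrArg (· + _) a₂)
  have u₁ := c₁.trans (congrArg (· + _) t₁)
  have u₂ := c₂.trans (congrArg (· + _) t₂)
  rw [a₁, a₂] at b₄
  rw [t₁, t₂] at c₄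
  rw [u₁, u₂] at d₄
  have h₁ : (l₁ 0 - l₀ 0) * p₀ 0 + (l₂ 0 - l₁ 0) * p₁ 0 + (l₃ 0 - l₂ 0) * p₂ 0
      + (l₀ 0 - l₃ 0) * p₃ 0 = 0 := by
    linear_combination -a₁ - b₁ - c₁ - d₁
  have h₂ : (l₁ 0 - l₀ 0) * p₀ 0 ^ 2 + (l₂ 0 - l₁ 0) * p₁ 0 ^ 2 + (l₃ 0 - l₂ 0) * p₂ 0 ^ 2
      + (l₀ 0 - l₃ 0) * p₃ 0 ^ 2 = 0 := by
    linear_combination -a₂ - b₂ - c₂ - d₂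
  have h₃ : (l₁ 0 - l₀ 0) * p₀ 0 ^ 3 + (l₂ 0 - l₁ 0) * p₁ 0 ^ 3 + (l₃ 0 - l₂ 0) * p₂ 0 ^ 3
      + (l₀ 0 - l₃ 0) * p₃ 0 ^ 3 = 0 := by
    linear_combination -a₃ - b₃ - c₃ - d₃
  refine no_closed_square (by ring) h₁ h₂ h₃ ?_ (j₀.point_zero_ne i₁ n₀) (j₁.point_zero_ne i₂ n₁)
    (j₂.point_zero_ne i₃ n₂) (j₃.point_zero_ne i₀ n₃)
    (i₀.line_zero_ne j₀ m₀) (i₁.line_zero_ne j₁ m₁) (i₂.line_zero_ne j₂ m₂)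
    (i₃.line_zero_ne j₃ m₃)
  linear_combination -a₄ - b₄ - c₄ - d₄ - l₀ 0 * h₃ + 2 * l₀ 1 * h₂ - l₀ 2 * h₁

theorem hexGraph_not_triangle {p₀ p₁ p₂ l₀ l₁ l₂ : Fin 5 → F}
    (i₀ : HexInc p₀ l₀) (j₀ : HexInc p₀ l₁) (i₁ : HexInc p₁ l₁) (j₁ : HexInc p₁ l₂)
    (i₂ : HexInc p₂ l₂) (j₂ : HexInc p₂ l₀)
    (n₁ : p₁ ≠ p₂) (n₂ : p₂ ≠ p₀) (m₂ : l₂ ≠ l₀) : False := by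
  obtain ⟨a₁, a₂, -⟩ := i₀.line_sub j₀
  obtain ⟨b₁, b₂, -⟩ := i₁.line_sub j₁
  obtain ⟨c₁, c₂, -⟩ := i₂.line_sub j₂
  have key : (l₀ 0 - l₂ 0) * ((p₂ 0 - p₀ 0) * (p₂ 0 - p₁ 0)) = 0 := by
    linear_combination -a₂ - b₂ - c₂ + (p₀ 0 + p₁ 0) * (a₁ + b₁ + c₁)
  simp [i₂.line_zero_ne j₂ m₂, sub_eq_zero, (j₁.point_zero_ne i₂ n₁).symm,
    j₂.point_zero_ne i₀ n₂] at key

theorem hexGraph_not_digon {p₀ p₁ l₀ l₁ : Fin 5 → F}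
    (i₀ : HexInc p₀ l₀) (j₀ : HexInc p₀ l₁) (i₁ : HexInc p₁ l₁) (j₁ : HexInc p₁ l₀)
    (n : p₁ ≠ p₀) (m : l₁ ≠ l₀) : False := by
  obtain ⟨a₁, -⟩ := i₀.line_sub j₀
  obtain ⟨b₁, -⟩ := i₁.line_sub j₁
  have key : (l₀ 0 - l₁ 0) * (p₁ 0 - p₀ 0) = 0 := by
    linear_combination -a₁ - b₁
  simp [i₁.line_zero_ne j₁ m, sub_eq_zero, j₁.point_zero_ne i₀ n] at key

theorem hexGraph_isRegularOfDegree [Fintype F] [DecidableRel (hexGraph F).Adj] :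
    (hexGraph F).IsRegularOfDegree (Fintype.card F) := by
  rintro (p | l)
  · rw [← SimpleGraph.card_neighborFinset_eq_degree, ← Finset.card_univ]
    symm
    refine Finset.card_bij (fun y _ => .inr (hexLine p y)) ?_ ?_ ?_
    · intro y _
      simpa using hexInc_hexLine p y
    · intro y _ z _ h
      exact congrFun (Sum.inr_injective h) 0
    · rintro (q | l) h
      · simp at h
      · exact ⟨l 0, Finset.mem_univ _,
          congrArg Sum.inr (hexInc_iff_eq_hexLine.1 (by simpa using h)).symm⟩
  · rw [← SimpleGraph.card_neighborFinset_eq_degree, ← Finset.card_univ]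
    symm
    refine Finset.card_bij (fun x _ => .inl (hexPoint l x)) ?_ ?_ ?_
    · intro x _
      simpa using hexInc_hexPoint l x
    · intro y _ z _ h
      exact congrFun (Sum.inl_injective h) 0
    · rintro (p | m) h
      · exact ⟨p 0, Finset.mem_univ _,
          congrArg Sum.inl (hexInc_iff_eq_hexPoint.1 (by simpa using h)).symm⟩
      · simp at h

theorem twelve_le_length_of_isCycle_inr {l : Fin 5 → F} {w : (hexGraph F).Walk (.inr l) (.inr l)}
    (hw : w.IsCycle) : 12 ≤ w.length := by
  have hlines : ∀ i, 2 * i ≤ w.length → ∃ m, w.getVert (2 * i) = .inr m := by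
    intro i
    induction i with
    | zero => exact fun _ => ⟨l, by simp⟩
    | succ i ih =>
      intro hi
      obtain ⟨m, hm⟩ := ih (by omega)
      have h₁ := w.adj_getVert_succ (i := 2 * i) (by omega)
      have h₂ := w.adj_getVert_succ (i := 2 * i + 1) (by omega)
      rw [hm] at h₁
      rw [show 2 * (i + 1) = 2 * i + 1 + 1 by ring]
      rcases h : w.getVert (2 * i + 1) with p | p
      · rw [h] at h₂
        rcases h' : w.getVert (2 * i + 1 + 1) with q | q
        · simp [h'] at h₂
        · exact ⟨q, rfl⟩
      · simp [h] at h₁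
  have hpoints : ∀ i, 2 * i < w.length → ∃ p, w.getVert (2 * i + 1) = .inl p := by
    intro i hi
    obtain ⟨m, hm⟩ := hlines i hi.le
    have h₁ := w.adj_getVert_succ hi
    rw [hm] at h₁
    rcases h : w.getVert (2 * i + 1) with p | p
    · exact ⟨p, rfl⟩
    · simp [h] at h₁
  have heven : Even w.length := by
    rcases Nat.even_or_odd' w.length with ⟨k, h | h⟩
    · exact ⟨k, by omega⟩
    · obtain ⟨p, hp⟩ := hpoints k (by omega)
      rw [← h, w.getVert_length] at hp
      cases hp
  obtain ⟨k, hk⟩ := heven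
  have hk2 : w.length = 2 * k := by omega
  choose! L hL using hlines
  choose! P hP using hpoints
  have hL0 : L 0 = l := by simpa using (hL 0 (by simp)).symm
  have hLk : L k = L 0 := by
    have := hL k hk2.ge
    rw [← hk2, w.getVert_length] at this
    rw [hL0]
    exact (Sum.inr_injective this).symm
  have hi : ∀ i, i < k → HexInc (P i) (L i) := by
    intro i hi
    have := w.adj_getVert_succ (i := 2 * i) (by omega)
    rwa [hL i (by omega), hP i (by omega)] at this
  have hj : ∀ i, i < k → HexInc (P i) (L (i + 1)) := by
    intro i hi
    have := w.adj_getVert_succ (i := 2 * i + 1) (by omega)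
    rwa [show 2 * i + 1 + 1 = 2 * (i + 1) by ring, hL (i + 1) (by omega), hP i (by omega)] at this
  have hn : ∀ i j, i < k → j < k → i ≠ j → P i ≠ P j := by
    intro i j hi hj hij h
    have := hw.getVert_injOn' (x₁ := 2 * i + 1) (by simp; omega) (x₂ := 2 * j + 1) (by simp; omega)
      (by rw [hP i (by omega), hP j (by omega), h])
    omega
  have hm : ∀ i j, i < k → j < k → i ≠ j → L i ≠ L j := by
    intro i j hi hj hij h
    have := hw.getVert_injOn' (x₁ := 2 * i) (by simp; omega) (x₂ := 2 * j) (by simp; omega)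
      (by rw [hL i (by omega), hL j (by omega), h])
    omega
  have h3 := hw.three_le_length
  by_contra! hlt
  obtain rfl | rfl | rfl | rfl : k = 2 ∨ k = 3 ∨ k = 4 ∨ k = 5 := by omega
  · exact hexGraph_not_digon (hi 0 (by simp)) (hj 0 (by simp)) (hi 1 (by simp))
      (hLk ▸ hj 1 (by simp)) (hn _ _ (by simp) (by simp) (by simp))
      (hm _ _ (by simp) (by simp) (by simp))
  · exact hexGraph_not_triangle (hi 0 (by simp)) (hj 0 (by simp)) (hi 1 (by simp))
      (hj 1 (by simp)) (hi 2 (by simp)) (hLk ▸ hj 2 (by simp))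
      (hn _ _ (by simp) (by simp) (by simp)) (hn _ _ (by simp) (by simp) (by simp))
      (hm _ _ (by simp) (by simp) (by simp))
  · apply hexGraph_not_square (hi 0 (by simp)) (hj 0 (by simp)) (hi 1 (by simp))
      (hj 1 (by simp)) (hi 2 (by simp)) (hj 2 (by simp)) (hi 3 (by simp)) (hLk ▸ hj 3 (by simp))
    iterate 4 exact hn _ _ (by simp) (by simp) (by simp)
    iterate 4 exact hm _ _ (by simp) (by simp) (by simp)
  · apply hexGraph_not_pentagon (hi 0 (by simp)) (hj 0 (by simp)) (hi 1 (by simp))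
      (hj 1 (by simp)) (hi 2 (by simp)) (hj 2 (by simp)) (hi 3 (by simp)) (hj 3 (by simp))
      (hi 4 (by simp)) (hLk ▸ hj 4 (by simp))
    iterate 5 exact hn _ _ (by simp) (by simp) (by simp)
    iterate 5 exact hm _ _ (by simp) (by simp) (by simp)

theorem twelve_le_egirth_hexGraph : 12 ≤ (hexGraph F).egirth := by
  classical
  rw [SimpleGraph.le_egirth]
  rintro (p | l) w hw
  · obtain ⟨l, hl⟩ : ∃ l, w.snd = .inr l := by
      have h := w.adj_snd hw.not_nil
      rcases e : w.snd with q | l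
      · simp [e] at h
      · exact ⟨l, rfl⟩
    have hmem : Sum.inr l ∈ w.support := hl ▸ w.getVert_mem_support 1
    have := twelve_le_length_of_isCycle_inr (hw.rotate hmem)
    rw [SimpleGraph.Walk.length_rotate] at this
    exact_mod_cast this
  · exact_mod_cast twelve_le_length_of_isCycle_inr hw

theorem exists_isCycle_length_eq_twelve {p₀ p₁ p₂ p₃ p₄ p₅ l₀ l₁ l₂ l₃ l₄ l₅ : Fin 5 → F}
    (i₀ : HexInc p₀ l₀) (j₀ : HexInc p₀ l₁) (i₁ : HexInc p₁ l₁) (j₁ : HexInc p₁ l₂)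
    (i₂ : HexInc p₂ l₂) (j₂ : HexInc p₂ l₃) (i₃ : HexInc p₃ l₃) (j₃ : HexInc p₃ l₄)
    (i₄ : HexInc p₄ l₄) (j₄ : HexInc p₄ l₅) (i₅ : HexInc p₅ l₅) (j₅ : HexInc p₅ l₀)
    (hp : [p₀, p₁, p₂, p₃, p₄, p₅].Nodup) (hl : [l₀, l₁, l₂, l₃, l₄, l₅].Nodup) :
    ∃ w : (hexGraph F).Walk (.inr l₀) (.inr l₀), w.IsCycle ∧ w.length = 12 := by
  let G := hexGraph F
  have A₀ : G.Adj (.inr l₀) (.inl p₀) := i₀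
  have B₀ : G.Adj (.inl p₀) (.inr l₁) := j₀
  have A₁ : G.Adj (.inr l₁) (.inl p₁) := i₁
  have B₁ : G.Adj (.inl p₁) (.inr l₂) := j₁
  have A₂ : G.Adj (.inr l₂) (.inl p₂) := i₂
  have B₂ : G.Adj (.inl p₂) (.inr l₃) := j₂
  have A₃ : G.Adj (.inr l₃) (.inl p₃) := i₃
  have B₃ : G.Adj (.inl p₃) (.inr l₄) := j₃
  have A₄ : G.Adj (.inr l₄) (.inl p₄) := i₄
  have B₄ : G.Adj (.inl p₄) (.inr l₅) := j₄
  have A₅ : G.Adj (.inr l₅) (.inl p₅) := i₅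
  have B₅ : G.Adj (.inl p₅) (.inr l₀) := j₅
  refine ⟨.cons A₀ <| .cons B₀ <| .cons A₁ <| .cons B₁ <| .cons A₂ <| .cons B₂ <|
    .cons A₃ <| .cons B₃ <| .cons A₄ <| .cons B₄ <| .cons A₅ <| .cons B₅ .nil, ?_, rfl⟩
  rw [SimpleGraph.Walk.isCycle_iff_isPath_tail_and_le_length]
  refine ⟨?_, by simp⟩
  rw [SimpleGraph.Walk.isPath_def]
  simp at hp hl ⊢
  grind

/-- A nonzero solution of the closing condition for hexagons in which opposite points have the same
first coordinate. -/
theorem exists_hexagon_parameters [Finite F] (hF : 3 ≤ Nat.card F) :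
    ∃ c v w : F, c ≠ 0 ∧ c ≠ 1 ∧ v ≠ 0 ∧ w ≠ 0 ∧ v + w * c ^ 3 + v * w * (c - 1) ^ 3 = 0 := by
  have := Fintype.ofFinite F
  classical
  obtain ⟨c, hc⟩ : ∃ c : F, c ∉ ({0, 1} : Finset F) := by
    by_contra! h
    have h1 := Finset.card_le_card (fun x _ => h x : Finset.univ ⊆ ({0, 1} : Finset F))
    rw [Finset.card_univ, ← Nat.card_eq_fintype_card] at h1
    have h2 := Finset.card_le_two (a := (0 : F)) (b := 1)
    omega
  simp only [Finset.mem_insert, Finset.mem_singleton, not_or] at hc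
  obtain ⟨h0, h1⟩ := hc
  have h1' : c - 1 ≠ 0 := sub_ne_zero.2 h1
  obtain ⟨v, hv, hd⟩ : ∃ v : F, v ≠ 0 ∧ c ^ 3 + v * (c - 1) ^ 3 ≠ 0 := by
    by_cases h : c ^ 3 + 1 * (c - 1) ^ 3 = 0
    · refine ⟨c, h0, fun h' => ?_⟩
      have : (c - 1) ^ 4 = 0 := by linear_combination h' - h
      exact h1' (pow_eq_zero_iff (by norm_num) |>.1 this)
    · exact ⟨1, one_ne_zero, h⟩
  refine ⟨c, v, -v / (c ^ 3 + v * (c - 1) ^ 3), h0, h1, hv, by simp [hv, hd], ?_⟩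
  field_simp
  ring

theorem nodup_hexagon_points {c v w : F} (hc : c ≠ 0) (hc1 : c ≠ 1) (hv : v ≠ 0) (hw : w ≠ 0) :
    [(0, 0, 0), (1, 1, 0), (c, c + c * v - v, v * (c - 1)),
        (0, -(v + c * w), -(v + c ^ 2 * w)), (1, (1 - c) * w, c * (1 - c) * w),
        (c, 0, 0)].Nodup := by
  simp only [List.nodup_cons, List.mem_cons, Prod.mk.injEq, List.not_mem_nil, List.nodup_nil,
    not_or]
  and_intros <;> grind

theorem nodup_hexagon_lines {c v w : F} (hc : c ≠ 0) (hc1 : c ≠ 1) (hv : v ≠ 0) (hw : w ≠ 0) :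
    [(0, 0, 0), (1, 0, 0), (1 + v, v, v), (1 + v + w, v + c * w, v + c ^ 2 * w),
        (v + w, v + c * w, v + c ^ 2 * w), (w, c * w, c ^ 2 * w)].Nodup := by
  simp only [List.nodup_cons, List.mem_cons, Prod.mk.injEq, List.not_mem_nil, List.nodup_nil,
    not_or]
  and_intros <;> grind

theorem hexGraph_girth [Finite F] (hF : 3 ≤ Nat.card F) : (hexGraph F).girth = 12 := by
  obtain ⟨c, v, w, hc, hc1, hv, hw, h⟩ := exists_hexagon_parameters hF
  have hc1' : c - 1 ≠ 0 := sub_ne_zero.2 hc1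
  let l₀ : Fin 5 → F := 0
  let p₀ := hexPoint l₀ 0
  let l₁ := hexLine p₀ 1
  let p₁ := hexPoint l₁ 1
  let l₂ := hexLine p₁ (1 + v)
  let p₂ := hexPoint l₂ c
  let l₃ := hexLine p₂ (1 + v + w)
  let p₃ := hexPoint l₃ 0
  let l₄ := hexLine p₃ (v + w)
  let p₄ := hexPoint l₄ 1
  let l₅ := hexLine p₄ w
  let p₅ := hexPoint l₅ c
  have hclose : l₀ = hexLine p₅ 0 := by
    simp only [hexLine, hexPoint, funext_iff, Fin.forall_fin_succ, l₀, l₁, l₂, l₃, l₄, l₅, p₀, p₁,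
      p₂, p₃, p₄, p₅]
    simp
    refine ⟨by ring, by ring, by ring, ?_⟩
    linear_combination -h
  have hp : [p₀, p₁, p₂, p₃, p₄, p₅].Nodup := by
    apply List.Nodup.of_map fun p => (p 0, p 1, p 2)
    convert nodup_hexagon_points hc hc1 hv hw using 1
    simp only [List.map, hexLine, hexPoint, l₀, l₁, l₂, l₃, l₄, l₅, p₀, p₁, p₂, p₃, p₄, p₅]
    simp
    ring_nf
    simp
  have hl : [l₀, l₁, l₂, l₃, l₄, l₅].Nodup := by
    apply List.Nodup.of_map fun l => (l 0, l 1, l 2)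
    convert nodup_hexagon_lines hc hc1 hv hw using 1
    simp only [List.map, hexLine, hexPoint, l₀, l₁, l₂, l₃, l₄, l₅, p₀, p₁, p₂, p₃, p₄]
    simp
    ring_nf
    simp
  obtain ⟨C, hC, hlen⟩ := exists_isCycle_length_eq_twelve (hexInc_hexPoint l₀ 0)
    (hexInc_hexLine p₀ 1) (hexInc_hexPoint l₁ 1) (hexInc_hexLine p₁ (1 + v))
    (hexInc_hexPoint l₂ c) (hexInc_hexLine p₂ (1 + v + w)) (hexInc_hexPoint l₃ 0)
    (hexInc_hexLine p₃ (v + w)) (hexInc_hexPoint l₄ 1) (hexInc_hexLine p₄ w)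
    (hexInc_hexPoint l₅ c) (hclose ▸ hexInc_hexLine p₅ 0) hp hl
  apply le_antisymm
  · exact hlen ▸ SimpleGraph.girth_le_length hC
  · have hne : (hexGraph F).egirth ≠ ⊤ := by
      rw [Ne, SimpleGraph.egirth_eq_top]
      exact fun hA => hA _ hC
    exact ENat.toNat_le_toNat twelve_le_egirth_hexGraph hne

end HexGraph

open SimpleGraph

/-- For every prime power `d ≥ 3` there exists a `d`-regular graph with
girth `12` and at most `2·d^5` vertices. -/
theorem stmt12 (d : ℕ) (hd : 3 ≤ d) (hpp : IsPrimePow d) :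
    ∃ (n : ℕ) (G : SimpleGraph (Fin n)) (_ : DecidableRel G.Adj),
      G.IsRegularOfDegree d ∧ G.girth = 12 ∧ n ≤ 2 * d ^ 5 := by
  classical
  obtain ⟨p, k, hp, hk, rfl⟩ := (isPrimePow_nat_iff d).1 hpp
  have : Fact p.Prime := ⟨hp⟩
  let F := GaloisField p k
  have := Fintype.ofFinite F
  have hF : Nat.card F = p ^ k := GaloisField.card p k hk.ne'
  let V := (Fin 5 → F) ⊕ (Fin 5 → F)
  let e : hexGraph F ≃g (hexGraph F).map (Fintype.equivFin V).toEmbedding :=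
    SimpleGraph.Iso.map (Fintype.equivFin V) (hexGraph F)
  refine ⟨Fintype.card V, (hexGraph F).map (Fintype.equivFin V).toEmbedding, inferInstance,
    fun x => ?_, ?_, ?_⟩
  · rw [← e.symm.degree_eq, hexGraph_isRegularOfDegree, ← Nat.card_eq_fintype_card, hF]
  · rw [← e.girth_eq, hexGraph_girth (hF ▸ hd)]
  · simp only [V, Fintype.card_sum, Fintype.card_fun, Fintype.card_fin]
    rw [← Nat.card_eq_fintype_card, hF]
    omega
end
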